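/- arXiv:2503.16890 — 12 statements merged into one kernel-verified Lean document; each statement's English description precedes it below -/
import Mathlib

section
/- The function g defined by g(x) = (1/8)(x + √(x²−4))² + ln(1 − √(1 − 4/x²)) − ln 2 for x > 2, extended by g(2) = 1/2 − ln 2, is strictly increasing on the interval [2, ∞). -/
/-- The function `g` from the paper: for `x > 2`,
`g(x) = (1/8)(x + √(x²−4))² + ln(1 − √(1 − 4/x²)) − ln 2`.
At `x = 2` the formula evaluates (since `√(2²−4) = 0` and `√(1−4/2²) = 0`)
to `1/2 − ln 2`, the value obtained by continuity. -/
noncomputable def g (x : ℝ) : ℝ :=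
  (1/8) * (x + Real.sqrt (x^2 - 4))^2 + Real.log (1 - Real.sqrt (1 - 4/x^2)) - Real.log 2

/-- With `u = ((x + √(x² - 4)) / 2)²`, the function `g` becomes `u / 2 - log (1 + u)`. -/
lemma g_eq_half_sub_log {x : ℝ} (hx : 2 ≤ x) :
    g x = ((x + √(x ^ 2 - 4)) / 2) ^ 2 / 2 - Real.log (1 + ((x + √(x ^ 2 - 4)) / 2) ^ 2) := by
  have hx0 : 0 < x := by linarith
  have hsqrt : √(1 - 4 / x ^ 2) = √(x ^ 2 - 4) / x := by
    rw [show 1 - 4 / x ^ 2 = (x ^ 2 - 4) / x ^ 2 by field_simp,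
      Real.sqrt_div' _ (sq_nonneg x), Real.sqrt_sq hx0.le]
  have hs : √(x ^ 2 - 4) ^ 2 = x ^ 2 - 4 := Real.sq_sqrt (by nlinarith)
  have hs0 : 0 ≤ √(x ^ 2 - 4) := Real.sqrt_nonneg _
  rw [g, hsqrt]
  generalize √(x ^ 2 - 4) = s at hs hs0 ⊢
  have hu : 0 < 1 + ((x + s) / 2) ^ 2 := by positivity
  have harg : 1 - s / x = 2 / (1 + ((x + s) / 2) ^ 2) := by
    rw [eq_div_iff hu.ne']
    field_simp
    linear_combination (-x - s) * hs
  rw [harg, Real.log_div two_ne_zero hu.ne']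
  ring

/-- The function `u / 2 - log (1 + u)` is strictly increasing on `[1, ∞)`. -/
lemma strictMonoOn_half_sub_log_one_add :
    StrictMonoOn (fun u : ℝ => u / 2 - Real.log (1 + u)) (Set.Ici 1) := by
  intro u hu v hv huv
  rw [Set.mem_Ici] at hu hv
  have hu0 : 0 < 1 + u := by linarith
  have hv0 : 0 < 1 + v := by linarith
  have hlog : Real.log ((1 + v) / (1 + u)) < (1 + v) / (1 + u) - 1 :=
    Real.log_lt_sub_one_of_pos (by positivity) (by rw [Ne, div_eq_one_iff_eq hu0.ne']; linarith)
  have hle : (1 + v) / (1 + u) - 1 ≤ (v - u) / 2 := by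
    rw [div_sub_one hu0.ne', add_sub_add_left_eq_sub]
    exact div_le_div_of_nonneg_left (by linarith) two_pos (by linarith)
  rw [Real.log_div hv0.ne' hu0.ne'] at hlog
  dsimp only
  linarith

/-- `g` is strictly increasing on `[2, ∞)`. -/
theorem g_strictMonoOn : StrictMonoOn g (Set.Ici (2:ℝ)) := by
  intro x hx y hy hxy
  rw [Set.mem_Ici] at hx hy
  have one_le {z : ℝ} (hz : 2 ≤ z) : 1 ≤ ((z + √(z ^ 2 - 4)) / 2) ^ 2 :=
    one_le_pow₀ (by linarith [Real.sqrt_nonneg (z ^ 2 - 4)])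
  rw [g_eq_half_sub_log hx, g_eq_half_sub_log hy]
  refine strictMonoOn_half_sub_log_one_add (one_le hx) (one_le hy) ?_
  have hsqrt : √(x ^ 2 - 4) ≤ √(y ^ 2 - 4) := by gcongr
  have hx0 := Real.sqrt_nonneg (x ^ 2 - 4)
  exact pow_lt_pow_left₀ (by linarith) (by linarith) two_ne_zero
end

section
/- The function g satisfies g(2) = 1/2 − ln 2 < 0 and g(x) → ∞ as x → ∞, and there exists a unique x* ∈ (2, ∞) such that g(x*) = 0. -/
/-- The square of the larger root `t` of `t + 1/t = x`. -/
noncomputable def sqRoot (x : ℝ) : ℝ := ((x + Real.sqrt (x^2 - 4)) / 2)^2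

lemma g_eq {x : ℝ} (hx : 2 ≤ x) : g x = sqRoot x / 2 - Real.log (1 + sqRoot x) := by
  have h0 : 0 ≤ x^2 - 4 := by nlinarith
  have hx0 : 0 < x := by linarith
  have hr := Real.sq_sqrt h0
  have hr0 := Real.sqrt_nonneg (x^2 - 4)
  have hq : Real.sqrt (1 - 4/x^2) = Real.sqrt (x^2 - 4) / x := by
    rw [show 1 - 4/x^2 = (x^2 - 4) / x^2 by field_simp, Real.sqrt_div h0, Real.sqrt_sq hx0.le]
  unfold g sqRoot
  rw [hq]
  set r := Real.sqrt (x^2 - 4)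
  have hpos : 0 < 1 + ((x + r) / 2)^2 := by positivity
  have key : 1 - r / x = 2 / (1 + ((x + r) / 2)^2) := by
    rw [eq_div_iff hpos.ne']
    field_simp
    linear_combination (-x - r) * hr
  rw [key, Real.log_div two_ne_zero hpos.ne']
  ring

lemma strictMonoOn_sqRoot : StrictMonoOn sqRoot (Set.Ici 2) := by
  intro x hx y _ hxy
  have hx : 2 ≤ x := hx
  have h : Real.sqrt (x^2 - 4) ≤ Real.sqrt (y^2 - 4) := Real.sqrt_le_sqrt (by nlinarith)
  have := Real.sqrt_nonneg (x^2 - 4)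
  exact pow_lt_pow_left₀ (by linarith) (by linarith) two_ne_zero

lemma half_le_sqRoot {x : ℝ} (hx : 2 ≤ x) : x / 2 ≤ sqRoot x := by
  have := Real.sqrt_nonneg (x^2 - 4)
  unfold sqRoot
  nlinarith

lemma strictMonoOn_half_sub_log :
    StrictMonoOn (fun s : ℝ => s / 2 - Real.log (1 + s)) (Set.Ici 1) := by
  intro a ha b _ hab
  have ha : 1 ≤ a := ha
  have ha1 : 0 < 1 + a := by linarith
  have hb1 : 0 < 1 + b := by linarith
  have hlog := Real.log_lt_sub_one_of_pos (div_pos hb1 ha1)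
    (by rw [Ne, div_eq_one_iff_eq ha1.ne']; linarith)
  rw [Real.log_div hb1.ne' ha1.ne'] at hlog
  have hle : (1 + b) / (1 + a) - 1 ≤ (b - a) / 2 := by
    rw [div_sub_one ha1.ne', div_le_div_iff₀ ha1 two_pos]
    nlinarith
  change a / 2 - Real.log (1 + a) < b / 2 - Real.log (1 + b)
  linarith

lemma one_le_sqRoot {x : ℝ} (hx : 2 ≤ x) : 1 ≤ sqRoot x := by
  linarith [half_le_sqRoot hx]

lemma strictMonoOn_g : StrictMonoOn g (Set.Ici 2) := by
  intro x hx y hy hxy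
  rw [g_eq hx, g_eq hy]
  exact strictMonoOn_half_sub_log (one_le_sqRoot hx) (one_le_sqRoot hy)
    (strictMonoOn_sqRoot hx hy hxy)

lemma continuousOn_g : ContinuousOn g (Set.Ici 2) := by
  have hs : Continuous sqRoot := by unfold sqRoot; fun_prop
  refine ContinuousOn.congr (f := fun x => sqRoot x / 2 - Real.log (1 + sqRoot x)) ?_
    fun x hx => g_eq hx
  refine (hs.div_const 2).continuousOn.sub
    ((continuous_const.add hs).continuousOn.log fun x hx => ?_)
  exact (add_pos_of_pos_of_nonneg one_pos (sq_nonneg _)).ne'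

lemma tendsto_g_atTop : Filter.Tendsto g Filter.atTop Filter.atTop := by
  have hlin : Filter.Tendsto (fun x : ℝ => x / 8 + -Real.log 4) Filter.atTop Filter.atTop :=
    Filter.tendsto_atTop_add_const_right _ _ (Filter.tendsto_id.atTop_div_const (by norm_num))
  refine Filter.tendsto_atTop_mono' _ ?_ hlin
  filter_upwards [Filter.eventually_ge_atTop 2] with x hx
  have hs := half_le_sqRoot hx
  have hpos : 0 < 1 + sqRoot x := by linarith
  have hlog := Real.log_le_sub_one_of_pos (div_pos hpos four_pos)
  rw [Real.log_div hpos.ne' four_ne_zero] at hlog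
  rw [g_eq hx]
  linarith

/-- `g(2) = 1/2 − ln 2 < 0`, `g(x) → ∞` as `x → ∞`, and there is a unique
`x* ∈ (2, ∞)` with `g(x*) = 0`. -/
theorem g_has_unique_zero :
    g 2 = 1/2 - Real.log 2 ∧ g 2 < 0 ∧
    Filter.Tendsto g Filter.atTop Filter.atTop ∧
    ∃! x : ℝ, 2 < x ∧ g x = 0 := by
  have h2 : g 2 = 1/2 - Real.log 2 := by
    rw [g_eq le_rfl]
    norm_num [sqRoot]
  have hneg : g 2 < 0 := by
    rw [h2]
    linarith [Real.log_two_gt_d9]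
  refine ⟨h2, hneg, tendsto_g_atTop, ?_⟩
  obtain ⟨M, hM, hM2⟩ :=
    ((tendsto_g_atTop.eventually_ge_atTop 0).and (Filter.eventually_ge_atTop 2)).exists
  obtain ⟨x, hx, hgx⟩ := intermediate_value_Icc hM2
    (continuousOn_g.mono Set.Icc_subset_Ici_self) ⟨hneg.le, hM⟩
  have hx2 : 2 < x := hx.1.lt_of_ne fun h => by
    rw [← h] at hgx
    exact hneg.ne hgx
  exact ⟨x, ⟨hx2, hgx⟩, fun y hy =>
    strictMonoOn_g.injOn (Set.mem_Ici.2 hy.1.le) (Set.mem_Ici.2 hx2.le) (hy.2.trans hgx.symm)⟩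
end

section
/- Let D > 0, p₁ > 0 and w > 0, and let f(c₁) = c₁²/2 + D·ln(w − p₁c₁) for c₁ ∈ [0, w/p₁). Set x₁ = (w + √(w² − 4Dp₁²))/(2p₁) and V(w, p₁) = (1/2)·((w + √(w² − 4Dp₁²))/(2p₁))² + D·ln((w − √(w² − 4Dp₁²))/2) (defined when w² ≥ 4Dp₁²). Then the set of maximizers of f on [0, w/p₁) equals: {0} if w² ≤ 4Dp₁²; {0} if w² > 4Dp₁² and V(w, p₁) < D·ln w; {0, x₁} if w² > 4Dp₁² and V(w, p₁) = D·ln w; and {x₁} if w² > 4Dp₁² and V(w, p₁) > D·ln w. -/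
/-- `f(c₁) = c₁²/2 + D ln(w − p₁ c₁)`. -/
noncomputable def fB (DD p1 w c : ℝ) : ℝ := c^2/2 + DD * Real.log (w - p1*c)

/-- The set of maximizers of `f` on `[0, w/p₁)`. -/
def argmaxB (DD p1 w : ℝ) : Set ℝ :=
  {c | c ∈ Set.Ico (0:ℝ) (w/p1) ∧
    ∀ c' ∈ Set.Ico (0:ℝ) (w/p1), fB DD p1 w c' ≤ fB DD p1 w c}

/-- `x₁ = (w + √(w² − 4Dp₁²))/(2p₁)`. -/
noncomputable def x1 (DD p1 w : ℝ) : ℝ := (w + Real.sqrt (w^2 - 4*DD*p1^2)) / (2*p1)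

/-- `V(w,p₁) = (1/2)((w + √(w² − 4Dp₁²))/(2p₁))² + D ln((w − √(w² − 4Dp₁²))/2)`. -/
noncomputable def Vfun (DD p1 w : ℝ) : ℝ :=
  (1/2) * ((w + Real.sqrt (w^2 - 4*DD*p1^2)) / (2*p1))^2
    + DD * Real.log ((w - Real.sqrt (w^2 - 4*DD*p1^2)) / 2)

theorem hasDerivAt_fB {DD p1 w c : ℝ} (hc : p1 * c < w) :
    HasDerivAt (fB DD p1 w) (c - DD * p1 / (w - p1 * c)) c := by
  have hlin : HasDerivAt (fun x : ℝ => w - p1 * x) (-p1) c := by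
    simpa using ((hasDerivAt_id c).const_mul p1).const_sub w
  have hsq : HasDerivAt (fun x : ℝ => x ^ 2 / 2) c c := by
    simpa using (hasDerivAt_pow 2 c).div_const 2
  have hlog := (hlin.log (sub_pos.2 hc).ne').const_mul DD
  exact (hsq.add hlog).congr_deriv (by ring)

/-- Completing the square in the numerator of the derivative of `fB`. -/
theorem deriv_fB_eq {DD p1 w c : ℝ} (hp : 0 < p1) (hc : p1 * c < w) :
    deriv (fB DD p1 w) c =
      (w ^ 2 - 4 * DD * p1 ^ 2 - (2 * p1 * c - w) ^ 2) / (4 * p1 * (w - p1 * c)) := by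
  have h : w - p1 * c ≠ 0 := (sub_pos.2 hc).ne'
  rw [(hasDerivAt_fB hc).deriv, sub_div' h,
    div_eq_div_iff h (mul_ne_zero (by positivity) h)]
  ring

theorem continuousOn_fB {DD p1 w : ℝ} {S : Set ℝ} (hS : ∀ c ∈ S, p1 * c < w) :
    ContinuousOn (fB DD p1 w) S :=
  fun c hc => (hasDerivAt_fB (hS c hc)).continuousAt.continuousWithinAt

theorem strictAntiOn_fB {DD p1 w : ℝ} {S : Set ℝ} (hp : 0 < p1) (hconv : Convex ℝ S)
    (hS : ∀ c ∈ S, p1 * c < w)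
    (hlt : ∀ c ∈ interior S, w ^ 2 - 4 * DD * p1 ^ 2 < (2 * p1 * c - w) ^ 2) :
    StrictAntiOn (fB DD p1 w) S := by
  refine strictAntiOn_of_deriv_neg hconv (continuousOn_fB hS) fun c hc => ?_
  have h := hS c (interior_subset hc)
  rw [deriv_fB_eq hp h]
  exact div_neg_of_neg_of_pos (sub_neg.2 (hlt c hc)) (mul_pos (by positivity) (sub_pos.2 h))

theorem strictMonoOn_fB {DD p1 w : ℝ} {S : Set ℝ} (hp : 0 < p1) (hconv : Convex ℝ S)
    (hS : ∀ c ∈ S, p1 * c < w)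
    (hlt : ∀ c ∈ interior S, (2 * p1 * c - w) ^ 2 < w ^ 2 - 4 * DD * p1 ^ 2) :
    StrictMonoOn (fB DD p1 w) S := by
  refine strictMonoOn_of_deriv_pos hconv (continuousOn_fB hS) fun c hc => ?_
  have h := hS c (interior_subset hc)
  rw [deriv_fB_eq hp h]
  exact div_pos (sub_pos.2 (hlt c hc)) (mul_pos (by positivity) (sub_pos.2 h))

theorem fB_zero (DD p1 w : ℝ) : fB DD p1 w 0 = DD * Real.log w := by
  simp [fB]

theorem fB_x1 {DD p1 w : ℝ} (hp : 0 < p1) : fB DD p1 w (x1 DD p1 w) = Vfun DD p1 w := by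
  have h : w - p1 * x1 DD p1 w = (w - √(w ^ 2 - 4 * DD * p1 ^ 2)) / 2 := by
    unfold x1
    field_simp
    ring
  rw [fB, h, Vfun, x1]
  ring

theorem x1_mem_Ico {DD p1 w : ℝ} (hD : 0 < DD) (hp : 0 < p1) (hw : 0 < w) :
    x1 DD p1 w ∈ Set.Ico 0 (w / p1) := by
  have hs : √(w ^ 2 - 4 * DD * p1 ^ 2) < w :=
    (Real.sqrt_lt' hw).2 (sub_lt_self _ (by positivity))
  refine ⟨by unfold x1; positivity, ?_⟩
  rw [x1, div_lt_div_iff₀ (by positivity) hp]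
  nlinarith

theorem fB_lt_fB_zero_of_sq_le {DD p1 w c : ℝ} (hp : 0 < p1) (hw : 0 < w)
    (h : w ^ 2 ≤ 4 * DD * p1 ^ 2) (hc : c ∈ Set.Ico 0 (w / p1)) (hc0 : c ≠ 0) :
    fB DD p1 w c < fB DD p1 w 0 := by
  have hpos : 0 < c := lt_of_le_of_ne hc.1 hc0.symm
  have hmid : p1 * (w / (2 * p1)) = w / 2 := by field_simp
  have hleft : StrictAntiOn (fB DD p1 w) (Set.Icc 0 (w / (2 * p1))) := by
    refine strictAntiOn_fB hp (convex_Icc _ _) (fun x hx => ?_) fun x hx => ?_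
    · have := mul_le_mul_of_nonneg_left hx.2 hp.le
      linarith
    · rw [interior_Icc] at hx
      have := mul_lt_mul_of_pos_left hx.2 hp
      nlinarith
  have hright : StrictAntiOn (fB DD p1 w) (Set.Ico (w / (2 * p1)) (w / p1)) := by
    refine strictAntiOn_fB hp (convex_Ico _ _) (fun x hx => (lt_div_iff₀' hp).1 hx.2)
      fun x hx => ?_
    rw [interior_Ico] at hx
    have := mul_lt_mul_of_pos_left hx.1 hp
    nlinarith
  have hm : 0 < w / (2 * p1) := by positivity
  rcases le_or_gt c (w / (2 * p1)) with hcm | hcm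
  · exact hleft ⟨le_rfl, hm.le⟩ ⟨hc.1, hcm⟩ hpos
  · exact (hright ⟨le_rfl, hcm.trans hc.2⟩ ⟨hcm.le, hc.2⟩ hcm).trans
      (hleft ⟨le_rfl, hm.le⟩ ⟨hm.le, le_rfl⟩ hm)

theorem fB_lt_fB_zero_or_lt_fB_x1 {DD p1 w c : ℝ} (hD : 0 < DD) (hp : 0 < p1) (hw : 0 < w)
    (h : 4 * DD * p1 ^ 2 < w ^ 2) (hc : c ∈ Set.Ico 0 (w / p1)) (hc0 : c ≠ 0)
    (hc1 : c ≠ x1 DD p1 w) :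
    fB DD p1 w c < fB DD p1 w 0 ∨ fB DD p1 w c < fB DD p1 w (x1 DD p1 w) := by
  have hpos : 0 < c := lt_of_le_of_ne hc.1 hc0.symm
  have hx1 := x1_mem_Ico hD hp hw
  set s := √(w ^ 2 - 4 * DD * p1 ^ 2) with hs
  have hs0 : 0 < s := Real.sqrt_pos.2 (sub_pos.2 h)
  have hs2 : s ^ 2 = w ^ 2 - 4 * DD * p1 ^ 2 := Real.sq_sqrt (sub_pos.2 h).le
  have hsw : s < w := (Real.sqrt_lt' hw).2 (sub_lt_self _ (by positivity))
  have hb : p1 * x1 DD p1 w = (w + s) / 2 := by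
    rw [x1, ← hs]
    field_simp
  obtain ⟨a, ha⟩ : ∃ a, p1 * a = (w - s) / 2 := ⟨(w - s) / 2 / p1, by field_simp⟩
  generalize x1 DD p1 w = b at *
  have ha0 : 0 < a := pos_of_mul_pos_right (by rw [ha]; linarith) hp.le
  have hab : a < b := lt_of_mul_lt_mul_left (by rw [ha, hb]; linarith) hp.le
  rcases le_or_gt c a with hca | hca
  · left
    have hanti : StrictAntiOn (fB DD p1 w) (Set.Icc 0 a) := by
      refine strictAntiOn_fB hp (convex_Icc _ _) (fun x hx => ?_) fun x hx => ?_
      · have := mul_le_mul_of_nonneg_left hx.2 hp.le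
        linarith
      · rw [interior_Icc] at hx
        have := mul_lt_mul_of_pos_left hx.2 hp
        nlinarith
    exact hanti ⟨le_rfl, ha0.le⟩ ⟨hc.1, hca⟩ hpos
  · right
    rcases lt_or_gt_of_ne hc1 with hcb | hcb
    · have hmono : StrictMonoOn (fB DD p1 w) (Set.Icc a b) := by
        refine strictMonoOn_fB hp (convex_Icc _ _) (fun x hx => ?_) fun x hx => ?_
        · have := mul_le_mul_of_nonneg_left hx.2 hp.le
          linarith
        · rw [interior_Icc] at hx
          have h₁ := mul_lt_mul_of_pos_left hx.1 hp
          have h₂ := mul_lt_mul_of_pos_left hx.2 hp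
          rw [← hs2]
          exact sq_lt_sq' (by linarith) (by linarith)
      exact hmono ⟨hca.le, hcb.le⟩ ⟨hab.le, le_rfl⟩ hcb
    · have hanti : StrictAntiOn (fB DD p1 w) (Set.Ico b (w / p1)) := by
        refine strictAntiOn_fB hp (convex_Ico _ _) (fun x hx => (lt_div_iff₀' hp).1 hx.2)
          fun x hx => ?_
        rw [interior_Ico] at hx
        have := mul_lt_mul_of_pos_left hx.1 hp
        nlinarith
      exact hanti ⟨le_rfl, hx1.2⟩ ⟨hcb.le, hc.2⟩ hcb

/-- If every value of `fB` off a set `T` of points sharing the value `v` is below `v`, then `T` is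
the set of maximizers. -/
theorem argmaxB_eq_of_forall_lt {DD p1 w v : ℝ} {T : Set ℝ} (hne : T.Nonempty)
    (hT : ∀ c ∈ T, c ∈ Set.Ico 0 (w / p1) ∧ fB DD p1 w c = v)
    (hlt : ∀ c ∈ Set.Ico 0 (w / p1), c ∉ T → fB DD p1 w c < v) :
    argmaxB DD p1 w = T := by
  ext c
  constructor
  · rintro ⟨hc, hmax⟩
    by_contra hcT
    obtain ⟨t, ht⟩ := hne
    have := hmax t (hT t ht).1
    linarith [hlt c hc hcT, (hT t ht).2]
  · intro hc
    refine ⟨(hT c hc).1, fun x hx => ?_⟩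
    rw [(hT c hc).2]
    by_cases hxT : x ∈ T
    · exact (hT x hxT).2.le
    · exact (hlt x hx hxT).le

/-- characterization of the set of maximizers of
`f(c₁) = c₁²/2 + D ln(w − p₁c₁)` on `[0, w/p₁)`. -/
theorem argmax_characterization (DD p1 w : ℝ) (hD : 0 < DD) (hp : 0 < p1) (hw : 0 < w) :
    (w^2 ≤ 4*DD*p1^2 → argmaxB DD p1 w = {0}) ∧
    (4*DD*p1^2 < w^2 → Vfun DD p1 w < DD * Real.log w → argmaxB DD p1 w = {0}) ∧
    (4*DD*p1^2 < w^2 → Vfun DD p1 w = DD * Real.log w →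
      argmaxB DD p1 w = {0, x1 DD p1 w}) ∧
    (4*DD*p1^2 < w^2 → DD * Real.log w < Vfun DD p1 w →
      argmaxB DD p1 w = {x1 DD p1 w}) := by
  have h0 : (0 : ℝ) ∈ Set.Ico 0 (w / p1) := ⟨le_rfl, by positivity⟩
  have h1 := x1_mem_Ico hD hp hw
  rw [← fB_zero DD p1 w, ← fB_x1 hp]
  refine ⟨fun h => ?_, fun h hV => ?_, fun h hV => ?_, fun h hV => ?_⟩
  · refine argmaxB_eq_of_forall_lt (v := fB DD p1 w 0) (Set.singleton_nonempty _) ?_ ?_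
    · rintro c rfl
      exact ⟨h0, rfl⟩
    · exact fun c hc hc0 => fB_lt_fB_zero_of_sq_le hp hw h hc hc0
  · refine argmaxB_eq_of_forall_lt (v := fB DD p1 w 0) (Set.singleton_nonempty _) ?_ ?_
    · rintro c rfl
      exact ⟨h0, rfl⟩
    · intro c hc hc0
      by_cases hc1 : c = x1 DD p1 w
      · rwa [hc1]
      · exact (fB_lt_fB_zero_or_lt_fB_x1 hD hp hw h hc hc0 hc1).elim id fun hlt => hlt.trans hV
  · refine argmaxB_eq_of_forall_lt (v := fB DD p1 w 0) (Set.insert_nonempty _ _) ?_ ?_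
    · rintro c (rfl | rfl)
      exacts [⟨h0, rfl⟩, ⟨h1, hV⟩]
    · intro c hc hcT
      rw [Set.mem_insert_iff, Set.mem_singleton_iff, not_or] at hcT
      exact (fB_lt_fB_zero_or_lt_fB_x1 hD hp hw h hc hcT.1 hcT.2).elim id
        fun hlt => hlt.trans_eq hV
  · refine argmaxB_eq_of_forall_lt (v := fB DD p1 w (x1 DD p1 w)) (Set.singleton_nonempty _) ?_ ?_
    · rintro c rfl
      exact ⟨h1, rfl⟩
    · intro c hc hc1
      by_cases hc0 : c = 0
      · rwa [hc0]
      · exact (fB_lt_fB_zero_or_lt_fB_x1 hD hp hw h hc hc0 hc1).elim (fun hlt => hlt.trans hV) id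
end

section
/- Let D > 0, p₁, p₂ > 0, set p = p₂/p₁, let e^B₁, e^B₂ > 0 and m = e^B₁ + p·e^B₂. Then the set of good-1 components of maximizers of U^B(c₁,c₂) = c₁²/2 + D·ln c₂ over the budget set {(c₁,c₂) : c₁ ≥ 0, c₂ > 0, p₁c₁ + p₂c₂ ≤ p₁e^B₁ + p₂e^B₂} equals: {0} if m < x*·√D; {0, (m + √(m² − 4D))/2} if m = x*·√D; and {(m + √(m² − 4D))/2} if m > x*·√D. -/
/-- Agent B's budget set at prices `p₁, p₂` with endowments `e^B₁, e^B₂`. -/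
def budgetB (p1 p2 eB1 eB2 : ℝ) : Set (ℝ × ℝ) :=
  {c | 0 ≤ c.1 ∧ 0 < c.2 ∧ p1*c.1 + p2*c.2 ≤ p1*eB1 + p2*eB2}

/-- Agent B's utility `U^B(c₁,c₂) = c₁²/2 + D ln c₂`. -/
noncomputable def UB (DD : ℝ) (c : ℝ × ℝ) : ℝ := c.1^2/2 + DD * Real.log c.2

/-- The set of good-1 components of maximizers of `U^B` on the budget set. -/
def demandB1 (DD p1 p2 eB1 eB2 : ℝ) : Set ℝ :=
  {y | ∃ c ∈ budgetB p1 p2 eB1 eB2,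
    (∀ c' ∈ budgetB p1 p2 eB1 eB2, UB DD c' ≤ UB DD c) ∧ y = c.1}

/-- Agent B's utility along the budget line, in units where `D = 1` and wealth is `x`. -/
noncomputable def lineUtility (x t : ℝ) : ℝ := t^2/2 + Real.log (x - t)

/-- Maximizers of `lineUtility x` over `[0, x)`. -/
def lineMaximizers (x : ℝ) : Set ℝ :=
  {t | t ∈ Set.Ico 0 x ∧ ∀ t' ∈ Set.Ico 0 x, lineUtility x t' ≤ lineUtility x t}

lemma hasDerivAt_lineUtility {x t : ℝ} (h : t < x) :
    HasDerivAt (lineUtility x) (t - 1 / (x - t)) t := by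
  have h1 : HasDerivAt (fun t : ℝ => t^2/2) t t :=
    ((hasDerivAt_pow 2 t).div_const 2).congr_deriv (by norm_num)
  have h2 : HasDerivAt (fun t : ℝ => Real.log (x - t)) (-1 / (x - t)) t :=
    ((hasDerivAt_id t).const_sub x).log (sub_pos.2 h).ne'
  exact (h1.add h2).congr_deriv (by ring)

lemma continuousOn_lineUtility {x : ℝ} {s : Set ℝ} (hs : ∀ t ∈ s, t < x) :
    ContinuousOn (lineUtility x) s := fun t ht =>
  (hasDerivAt_lineUtility (hs t ht)).continuousAt.continuousWithinAt

/-- Off the two candidates `0` and `b`, the line utility is beaten by one of them. -/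
lemma lineUtility_lt_of_ne {a b t : ℝ} (ha : 0 < a) (hab : a < b) (h1 : a * b = 1)
    (ht : t ∈ Set.Ico 0 (a + b)) (ht0 : t ≠ 0) (htb : t ≠ b) :
    lineUtility (a + b) t < lineUtility (a + b) 0 ∨
      lineUtility (a + b) t < lineUtility (a + b) b := by
  have hderiv : ∀ u < a + b,
      deriv (lineUtility (a + b)) u = (u - a) * (b - u) / (a + b - u) := by
    intro u hu
    rw [(hasDerivAt_lineUtility hu).deriv]
    have : a + b - u ≠ 0 := (sub_pos.2 hu).ne'
    field_simp
    linear_combination h1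
  obtain ⟨ht1, ht2⟩ := ht
  have htpos : 0 < t := lt_of_le_of_ne ht1 ht0.symm
  rcases le_or_gt t a with hta | hta
  · left
    have hanti : StrictAntiOn (lineUtility (a + b)) (Set.Icc 0 a) := by
      apply strictAntiOn_of_deriv_neg (convex_Icc 0 a)
      · exact continuousOn_lineUtility fun u hu => by linarith [hu.2]
      · intro u hu
        rw [interior_Icc] at hu
        rw [hderiv u (by linarith [hu.2])]
        exact div_neg_of_neg_of_pos
          (mul_neg_of_neg_of_pos (by linarith [hu.2]) (by linarith [hu.2])) (by linarith [hu.2])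
    exact hanti ⟨le_rfl, ha.le⟩ ⟨ht1, hta⟩ htpos
  right
  rcases lt_or_gt_of_ne htb with htb | htb
  · have hmono : StrictMonoOn (lineUtility (a + b)) (Set.Icc a b) := by
      apply strictMonoOn_of_deriv_pos (convex_Icc a b)
      · exact continuousOn_lineUtility fun u hu => by linarith [hu.2]
      · intro u hu
        rw [interior_Icc] at hu
        rw [hderiv u (by linarith [hu.2])]
        exact div_pos (mul_pos (by linarith [hu.1]) (by linarith [hu.2])) (by linarith [hu.2])
    exact hmono ⟨hta.le, htb.le⟩ ⟨hab.le, le_rfl⟩ htb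
  · have hanti : StrictAntiOn (lineUtility (a + b)) (Set.Ico b (a + b)) := by
      apply strictAntiOn_of_deriv_neg (convex_Ico b (a + b))
      · exact continuousOn_lineUtility fun u hu => hu.2
      · intro u hu
        rw [interior_Ico] at hu
        rw [hderiv u hu.2]
        exact div_neg_of_neg_of_pos
          (mul_neg_of_pos_of_neg (by linarith [hu.1]) (by linarith [hu.1])) (by linarith [hu.2])
    exact hanti ⟨le_rfl, by linarith⟩ ⟨htb.le, ht2⟩ htb

/-- The larger root of `t (x - t) = 1`. -/
noncomputable def upperRoot (x : ℝ) : ℝ := (x + Real.sqrt (x^2 - 4)) / 2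

lemma upperRoot_mem_Ioo {x : ℝ} (hx : 2 < x) : upperRoot x ∈ Set.Ioo 0 x := by
  have hlt : Real.sqrt (x^2 - 4) < x := by
    rw [Real.sqrt_lt' (by linarith)]
    linarith
  have := Real.sqrt_nonneg (x^2 - 4)
  constructor <;> unfold upperRoot <;> linarith

lemma lineUtility_lt_zero_or_upperRoot {x t : ℝ} (hx : 2 < x) (ht : t ∈ Set.Ico 0 x)
    (ht0 : t ≠ 0) (htb : t ≠ upperRoot x) :
    lineUtility x t < lineUtility x 0 ∨ lineUtility x t < lineUtility x (upperRoot x) := by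
  have hsq : Real.sqrt (x^2 - 4) ^ 2 = x^2 - 4 := Real.sq_sqrt (by nlinarith)
  have hpos : 0 < Real.sqrt (x^2 - 4) := Real.sqrt_pos.2 (by nlinarith)
  have hsum : x - upperRoot x + upperRoot x = x := by ring
  have key := lineUtility_lt_of_ne (a := x - upperRoot x) (b := upperRoot x) (t := t)
    (by linarith [(upperRoot_mem_Ioo hx).2]) (by unfold upperRoot; linarith)
    (by unfold upperRoot; linear_combination -hsq / 4) (by rwa [hsum]) ht0 htb
  rwa [hsum] at key

/-- `g` is the utility gain from moving from `0` to `upperRoot x`. -/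
lemma g_eq_lineUtility_sub {x : ℝ} (hx : 2 < x) :
    g x = lineUtility x (upperRoot x) - lineUtility x 0 := by
  have hx0 : 0 < x := by linarith
  have hsqrt : Real.sqrt (1 - 4/x^2) = Real.sqrt (x^2 - 4) / x := by
    rw [show 1 - 4/x^2 = (x^2 - 4) / x^2 by field_simp, Real.sqrt_div' _ (sq_nonneg x),
      Real.sqrt_sq hx0.le]
  have hroot := (upperRoot_mem_Ioo hx).2
  have harg : 1 - Real.sqrt (1 - 4/x^2) = 2 * (x - upperRoot x) / x := by
    rw [hsqrt, upperRoot]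
    field_simp
    ring
  unfold g lineUtility
  rw [harg, Real.log_div (by linarith) hx0.ne', Real.log_mul two_ne_zero (by linarith), sub_zero]
  unfold upperRoot
  ring

/-- The gain from moving from `0` to `t > 0` strictly increases with wealth. -/
lemma lineUtility_gain_lt {x x' t : ℝ} (ht : 0 < t) (htx : t < x) (hxx' : x < x') :
    lineUtility x t - lineUtility x 0 < lineUtility x' t - lineUtility x' 0 := by
  have h : Real.log ((x - t) * x') < Real.log ((x' - t) * x) :=
    Real.log_lt_log (mul_pos (by linarith) (by linarith)) (by nlinarith)
  rw [Real.log_mul (by linarith) (by linarith), Real.log_mul (by linarith) (by linarith)] at h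
  simp only [lineUtility, sub_zero]
  linarith

lemma lineUtility_lt_zero_of_root {xs t : ℝ} (hxs : 2 < xs) (hg : g xs = 0)
    (ht : t ∈ Set.Ico 0 xs) (ht0 : t ≠ 0) (htb : t ≠ upperRoot xs) :
    lineUtility xs t < lineUtility xs 0 := by
  rw [g_eq_lineUtility_sub hxs] at hg
  rcases lineUtility_lt_zero_or_upperRoot hxs ht ht0 htb with h | h <;> linarith

lemma lineMaximizers_of_lt {x xs : ℝ} (hx : 0 < x) (hxs : 2 < xs) (hg : g xs = 0)
    (hlt : x < xs) : lineMaximizers x = {0} := by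
  have key : ∀ t ∈ Set.Ico 0 x, t ≠ 0 → lineUtility x t < lineUtility x 0 := by
    intro t ht ht0
    have hgain := lineUtility_gain_lt (lt_of_le_of_ne ht.1 ht0.symm) ht.2 hlt
    by_cases htb : t = upperRoot xs
    · rw [g_eq_lineUtility_sub hxs, ← htb] at hg
      linarith
    · linarith [lineUtility_lt_zero_of_root hxs hg ⟨ht.1, ht.2.trans hlt⟩ ht0 htb]
  ext t
  rw [Set.mem_singleton_iff]
  constructor
  · rintro ⟨ht, hmax⟩
    by_contra ht0
    exact absurd (hmax 0 ⟨le_rfl, hx⟩) (not_le.2 (key t ht ht0))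
  · rintro rfl
    refine ⟨⟨le_rfl, hx⟩, fun t ht => ?_⟩
    by_cases ht0 : t = 0
    · rw [ht0]
    · exact (key t ht ht0).le

lemma lineMaximizers_of_root {xs : ℝ} (hxs : 2 < xs) (hg : g xs = 0) :
    lineMaximizers xs = {0, upperRoot xs} := by
  have hroot := upperRoot_mem_Ioo hxs
  have heq : lineUtility xs (upperRoot xs) = lineUtility xs 0 := by
    rw [g_eq_lineUtility_sub hxs] at hg
    linarith
  have hle : ∀ t ∈ Set.Ico 0 xs, lineUtility xs t ≤ lineUtility xs 0 := by
    intro t ht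
    by_cases ht0 : t = 0
    · rw [ht0]
    by_cases htb : t = upperRoot xs
    · rw [htb, heq]
    exact (lineUtility_lt_zero_of_root hxs hg ht ht0 htb).le
  ext t
  rw [Set.mem_insert_iff, Set.mem_singleton_iff]
  constructor
  · rintro ⟨ht, hmax⟩
    by_contra! hne
    exact absurd (hmax 0 ⟨le_rfl, by linarith⟩)
      (not_le.2 (lineUtility_lt_zero_of_root hxs hg ht hne.1 hne.2))
  · rintro (rfl | rfl)
    · exact ⟨⟨le_rfl, by linarith⟩, hle⟩
    · exact ⟨⟨hroot.1.le, hroot.2⟩, fun t ht => heq ▸ hle t ht⟩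

lemma lineMaximizers_of_gt {x xs : ℝ} (hxs : 2 < xs) (hg : g xs = 0) (hlt : xs < x) :
    lineMaximizers x = {upperRoot x} := by
  have hx : 2 < x := hxs.trans hlt
  have hroot := upperRoot_mem_Ioo hx
  have hzero : lineUtility x 0 < lineUtility x (upperRoot x) := by
    have hroots := upperRoot_mem_Ioo hxs
    have hgain := lineUtility_gain_lt hroots.1 hroots.2 hlt
    rw [← g_eq_lineUtility_sub hxs, hg] at hgain
    by_cases h : upperRoot xs = upperRoot x
    · rw [← h]
      linarith
    · rcases lineUtility_lt_zero_or_upperRoot hx ⟨hroots.1.le, hroots.2.trans hlt⟩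
        hroots.1.ne' h with h | h <;> linarith
  have key : ∀ t ∈ Set.Ico 0 x, t ≠ upperRoot x →
      lineUtility x t < lineUtility x (upperRoot x) := by
    intro t ht htb
    by_cases ht0 : t = 0
    · rwa [ht0]
    rcases lineUtility_lt_zero_or_upperRoot hx ht ht0 htb with h | h <;> linarith
  ext t
  rw [Set.mem_singleton_iff]
  constructor
  · rintro ⟨ht, hmax⟩
    by_contra htb
    exact absurd (hmax _ ⟨hroot.1.le, hroot.2⟩) (not_le.2 (key t ht htb))
  · rintro rfl
    refine ⟨⟨hroot.1.le, hroot.2⟩, fun t ht => ?_⟩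
    by_cases htb : t = upperRoot x
    · rw [htb]
    · exact (key t ht htb).le

/-- On the budget line, utility is an increasing affine function of `lineUtility`. -/
lemma UB_budget_line {s p x t : ℝ} (hs : 0 < s) (hp : 0 < p) (ht : t < x) :
    UB (s^2) (s * t, s * (x - t) / p) =
      s^2 * lineUtility x t + s^2 * (Real.log s - Real.log p) := by
  have hxt : 0 < x - t := sub_pos.2 ht
  simp only [UB, lineUtility]
  rw [Real.log_div (by positivity) hp.ne', Real.log_mul hs.ne' hxt.ne']
  ring

lemma mem_budgetB_iff {p1 p2 eB1 eB2 : ℝ} (hp1 : 0 < p1) (c : ℝ × ℝ) :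
    c ∈ budgetB p1 p2 eB1 eB2 ↔
      0 ≤ c.1 ∧ 0 < c.2 ∧ c.1 + p2 / p1 * c.2 ≤ eB1 + p2 / p1 * eB2 := by
  have h1 : p1 * c.1 + p2 * c.2 = p1 * (c.1 + p2 / p1 * c.2) := by field_simp
  have h2 : p1 * eB1 + p2 * eB2 = p1 * (eB1 + p2 / p1 * eB2) := by field_simp
  unfold budgetB
  rw [Set.mem_ofPred_eq, h1, h2, mul_le_mul_iff_right₀ hp1]

lemma demandB1_eq_image {s p1 p2 eB1 eB2 x : ℝ} (hs : 0 < s) (hp1 : 0 < p1) (hp2 : 0 < p2)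
    (hm : eB1 + p2 / p1 * eB2 = s * x) :
    demandB1 (s^2) p1 p2 eB1 eB2 = (fun t => s * t) '' lineMaximizers x := by
  set p := p2 / p1 with hpdef
  have hp : 0 < p := div_pos hp2 hp1
  have hmem : ∀ c : ℝ × ℝ, c ∈ budgetB p1 p2 eB1 eB2 ↔
      0 ≤ c.1 ∧ 0 < c.2 ∧ c.1 + p * c.2 ≤ s * x := by
    intro c
    rw [mem_budgetB_iff hp1, ← hpdef, hm]
  have hline : ∀ t ∈ Set.Ico 0 x, (s * t, s * (x - t) / p) ∈ budgetB p1 p2 eB1 eB2 := by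
    intro t ht
    rw [hmem]
    have := sub_pos.2 ht.2
    refine ⟨mul_nonneg hs.le ht.1, by positivity, le_of_eq ?_⟩
    field_simp
    ring
  have hbound : ∀ c ∈ budgetB p1 p2 eB1 eB2, c.1 / s ∈ Set.Ico 0 x ∧
      UB (s^2) c ≤ UB (s^2) (s * (c.1 / s), s * (x - c.1 / s) / p) := by
    intro c hc
    obtain ⟨h1, h2, h3⟩ := (hmem c).1 hc
    have hpc := mul_pos hp h2
    refine ⟨⟨by positivity, by rw [div_lt_iff₀ hs]; linarith⟩, ?_⟩
    have hc1 : s * (c.1 / s) = c.1 := mul_div_cancel₀ _ hs.ne'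
    have hle : c.2 ≤ s * (x - c.1 / s) / p := by
      rw [le_div_iff₀ hp, mul_sub, hc1]
      linarith
    simp only [UB, hc1]
    gcongr
  ext y
  constructor
  · rintro ⟨c, hc, hmax, rfl⟩
    obtain ⟨ht, hle⟩ := hbound c hc
    refine ⟨c.1 / s, ⟨ht, fun t' ht' => ?_⟩, mul_div_cancel₀ _ hs.ne'⟩
    have h := (hmax _ (hline t' ht')).trans hle
    rw [UB_budget_line hs hp ht'.2, UB_budget_line hs hp ht.2] at h
    exact le_of_mul_le_mul_left (by linarith) (pow_pos hs 2)
  · rintro ⟨t, ⟨ht, hmax⟩, rfl⟩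
    refine ⟨_, hline t ht, fun c' hc' => ?_, rfl⟩
    obtain ⟨ht', hle⟩ := hbound c' hc'
    refine hle.trans ?_
    rw [UB_budget_line hs hp ht'.2, UB_budget_line hs hp ht.2]
    gcongr
    exact hmax _ ht'

lemma mul_upperRoot {s x : ℝ} (hs : 0 < s) :
    s * upperRoot x = (s * x + Real.sqrt ((s * x)^2 - 4 * s^2)) / 2 := by
  rw [show (s * x)^2 - 4 * s^2 = s^2 * (x^2 - 4) by ring, Real.sqrt_mul (sq_nonneg s),
    Real.sqrt_sq hs.le, upperRoot]
  ring

/-- characterization of agent B's good-1 demand correspondence,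
where `x*` (here `xs`) is the unique zero of `g` on `(2,∞)` and `m = e^B₁ + p e^B₂`
with `p = p₂/p₁`. -/
theorem demandB1_characterization (DD p1 p2 eB1 eB2 xs : ℝ)
    (hD : 0 < DD) (hp1 : 0 < p1) (hp2 : 0 < p2) (hB1 : 0 < eB1) (hB2 : 0 < eB2)
    (hxs2 : 2 < xs) (hxs0 : g xs = 0) :
    (eB1 + (p2/p1)*eB2 < xs * Real.sqrt DD →
      demandB1 DD p1 p2 eB1 eB2 = {0}) ∧
    (eB1 + (p2/p1)*eB2 = xs * Real.sqrt DD →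
      demandB1 DD p1 p2 eB1 eB2 =
        {0, (eB1 + (p2/p1)*eB2 + Real.sqrt ((eB1 + (p2/p1)*eB2)^2 - 4*DD))/2}) ∧
    (xs * Real.sqrt DD < eB1 + (p2/p1)*eB2 →
      demandB1 DD p1 p2 eB1 eB2 =
        {(eB1 + (p2/p1)*eB2 + Real.sqrt ((eB1 + (p2/p1)*eB2)^2 - 4*DD))/2}) := by
  obtain ⟨s, hs, rfl⟩ : ∃ s, 0 < s ∧ DD = s^2 :=
    ⟨Real.sqrt DD, Real.sqrt_pos.2 hD, (Real.sq_sqrt hD.le).symm⟩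
  obtain ⟨x, hm⟩ : ∃ x, eB1 + p2 / p1 * eB2 = s * x :=
    ⟨(eB1 + p2 / p1 * eB2) / s, (mul_div_cancel₀ _ hs.ne').symm⟩
  have hx : 0 < x := by
    have : 0 < s * x := by rw [← hm]; positivity
    exact pos_of_mul_pos_right this hs.le
  rw [demandB1_eq_image hs hp1 hp2 hm, hm, Real.sqrt_sq hs.le, mul_comm xs s,
    ← mul_upperRoot hs]
  refine ⟨fun h => ?_, fun h => ?_, fun h => ?_⟩
  · rw [lineMaximizers_of_lt hx hxs2 hxs0 (lt_of_mul_lt_mul_left h hs.le), Set.image_singleton,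
      mul_zero]
  · obtain rfl := mul_left_cancel₀ hs.ne' h
    rw [lineMaximizers_of_root hxs2 hxs0, Set.image_pair, mul_zero]
  · rw [lineMaximizers_of_gt hxs2 hxs0 (lt_of_mul_lt_mul_left h hs.le), Set.image_singleton]
end

section
/- Consider a two-good, two-agent exchange economy with endowments e^A₁, e^A₂, e^B₁, e^B₂ > 0, where agent A's utility U^A is continuous and strictly increasing in each component and for every p > 0 admits a unique demand (c^A₁(p), c^A₂(p)) over the budget set {(c₁,c₂) : c₁, c₂ ≥ 0, c₁ + p·c₂ ≤ e^A₁ + p·e^A₂}, and agent B has utility U^B(c₁,c₂) = c₁²/2 + D·ln c₂ with D > 0. If there exists p > 0 such that c^A₁(p) = e^A₁ + e^B₁ and e^B₁ + p·e^B₂ < x*·√D, then there exists an equilibrium with c^B₁ = 0 and relative price p₂/p₁ = p. -/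
/-- Agent B's utility `U^B(c₁,c₂) = c₁²/2 + D ln c₂`. -/
noncomputable def UBf (DD : ℝ) (c : ℝ × ℝ) : ℝ := c.1^2/2 + DD * Real.log c.2

/-- Equilibrium: A maximizes `UA` on `{c ≥ 0 : p₁c₁ + p₂c₂ ≤ p₁e^A₁ + p₂e^A₂}`,
B maximizes `U^B(c₁,c₂) = c₁²/2 + D ln c₂` on `{c₁ ≥ 0, c₂ > 0 : p₁c₁ + p₂c₂ ≤ p₁e^B₁ + p₂e^B₂}`,
and both markets clear. -/
def IsEquil (UA : ℝ × ℝ → ℝ) (DD eA1 eA2 eB1 eB2 p1 p2 : ℝ) (cA cB : ℝ × ℝ) : Prop :=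
  0 < p1 ∧ 0 < p2 ∧
  (0 ≤ cA.1 ∧ 0 ≤ cA.2 ∧ p1*cA.1 + p2*cA.2 ≤ p1*eA1 + p2*eA2) ∧
  (∀ c : ℝ × ℝ, 0 ≤ c.1 → 0 ≤ c.2 → p1*c.1 + p2*c.2 ≤ p1*eA1 + p2*eA2 → UA c ≤ UA cA) ∧
  (0 ≤ cB.1 ∧ 0 < cB.2 ∧ p1*cB.1 + p2*cB.2 ≤ p1*eB1 + p2*eB2) ∧
  (∀ c : ℝ × ℝ, 0 ≤ c.1 → 0 < c.2 → p1*c.1 + p2*c.2 ≤ p1*eB1 + p2*eB2 →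
    UBf DD c ≤ UBf DD cB) ∧
  cA.1 + cB.1 = eA1 + eB1 ∧ cA.2 + cB.2 = eA2 + eB2

/-- If the larger critical value, at `a`, is zero, then so is the maximum of the function
`s ↦ k s² / 2 + log (1 - s)` over `[0, 1)`. -/
lemma half_mul_sq_add_log_one_sub_nonpos {k a : ℝ} (hk : 0 < k) (ha : 1 / 2 ≤ a) (ha1 : a < 1)
    (hcrit : k * a * (1 - a) = 1) (hval : k * a ^ 2 / 2 + Real.log (1 - a) = 0)
    {s : ℝ} (hs0 : 0 ≤ s) (hs1 : s < 1) : k * s ^ 2 / 2 + Real.log (1 - s) ≤ 0 := by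
  have hderiv : ∀ x : ℝ, x < 1 →
      HasDerivAt (fun s : ℝ => k * s ^ 2 / 2 + Real.log (1 - s))
        (k * (x - (1 - a)) * (a - x) / (1 - x)) x := by
    intro x hx
    have hx' : 1 - x ≠ 0 := by linarith
    have hlog := ((hasDerivAt_id x).const_sub 1).log hx'
    have hsq := ((hasDerivAt_pow 2 x).const_mul k).div_const 2
    refine (hsq.add hlog).congr_deriv ?_
    simp only [id]
    field_simp
    push_cast
    linear_combination 2 * hcrit
  have mean_value : ∀ u v : ℝ, u < v → v < 1 → ∃ x ∈ Set.Ioo u v,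
      (k * v ^ 2 / 2 + Real.log (1 - v)) - (k * u ^ 2 / 2 + Real.log (1 - u)) =
        k * ((x - (1 - a)) * (a - x)) * ((v - u) / (1 - x)) := by
    intro u v huv hv
    obtain ⟨x, hx, hslope⟩ := exists_hasDerivAt_eq_slope
      (fun s : ℝ => k * s ^ 2 / 2 + Real.log (1 - s)) _ huv
      (fun x hx => (hderiv x (hx.2.trans_lt hv)).continuousAt.continuousWithinAt)
      (fun x hx => hderiv x (hx.2.trans hv))
    refine ⟨x, hx, ?_⟩
    rw [eq_div_iff (by linarith)] at hslope
    rw [← hslope]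
    ring
  have weight_nonneg : ∀ u v x : ℝ, x ∈ Set.Ioo u v → v < 1 → 0 ≤ (v - u) / (1 - x) :=
    fun u v x hx hv => div_nonneg (by linarith [hx.1, hx.2]) (by linarith [hx.2])
  rcases lt_trichotomy s a with hsa | rfl | hsa
  · rcases le_or_gt s (1 - a) with hsb | hsb
    · rcases hs0.eq_or_lt with rfl | hpos
      · simp
      · obtain ⟨x, hx, h⟩ := mean_value 0 s hpos hs1
        have hsign : (x - (1 - a)) * (a - x) ≤ 0 :=
          mul_nonpos_of_nonpos_of_nonneg (by linarith [hx.2]) (by linarith [hx.2])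
        have := mul_nonpos_of_nonpos_of_nonneg (mul_nonpos_of_nonneg_of_nonpos hk.le hsign)
          (weight_nonneg 0 s x hx hs1)
        norm_num at h this
        linarith
    · obtain ⟨x, hx, h⟩ := mean_value s a hsa ha1
      have hsign : 0 ≤ (x - (1 - a)) * (a - x) :=
        mul_nonneg (by linarith [hx.1]) (by linarith [hx.2])
      have := mul_nonneg (mul_nonneg hk.le hsign) (weight_nonneg s a x hx ha1)
      linarith
  · exact hval.le
  · obtain ⟨x, hx, h⟩ := mean_value a s hsa hs1
    have hsign : (x - (1 - a)) * (a - x) ≤ 0 :=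
      mul_nonpos_of_nonneg_of_nonpos (by linarith [hx.1]) (by linarith [hx.1])
    have := mul_nonpos_of_nonpos_of_nonneg (mul_nonpos_of_nonneg_of_nonpos hk.le hsign)
      (weight_nonneg a s x hx hs1)
    linarith

/-- At a zero `x > 2` of `g`, no share of wealth spent on the first good beats the corner. -/
lemma corner_share_optimal_of_g_eq_zero {x : ℝ} (hx : 2 < x) (hg : g x = 0)
    {s : ℝ} (hs0 : 0 ≤ s) (hs1 : s < 1) : x ^ 2 * s ^ 2 / 2 + Real.log (1 - s) ≤ 0 := by
  have hx0 : 0 < x := by linarith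
  have hlt : 4 / x ^ 2 < 1 := by rw [div_lt_one (by positivity)]; nlinarith
  have hpos : 0 < 4 / x ^ 2 := by positivity
  have hroot : √(x ^ 2 - 4) = x * √(1 - 4 / x ^ 2) := by
    rw [show x ^ 2 - 4 = x ^ 2 * (1 - 4 / x ^ 2) by field_simp,
      Real.sqrt_mul (by positivity), Real.sqrt_sq hx0.le]
  have hsq : √(1 - 4 / x ^ 2) ^ 2 = 1 - 4 / x ^ 2 := Real.sq_sqrt (by linarith)
  have hr0 : 0 ≤ √(1 - 4 / x ^ 2) := Real.sqrt_nonneg _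
  unfold g at hg
  rw [hroot] at hg
  generalize √(1 - 4 / x ^ 2) = r at hg hsq hr0
  have hr1 : r < 1 := by nlinarith
  have hsq' : x ^ 2 * r ^ 2 = x ^ 2 - 4 := by rw [hsq]; field_simp
  refine half_mul_sq_add_log_one_sub_nonpos (a := (1 + r) / 2) (by positivity) (by linarith)
    (by linarith) ?_ ?_ hs0 hs1
  · linear_combination (-1 / 4) * hsq'
  · rw [show 1 - (1 + r) / 2 = (1 - r) / 2 by ring, Real.log_div (by linarith) (by norm_num)]
    linear_combination hg

/-- For wealth `w` below the threshold, agent B spends everything on the second good. -/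
lemma UBf_le_corner {DD x p w : ℝ} (hD : 0 < DD) (hx : 2 < x) (hg : g x = 0) (hp : 0 < p)
    (hw : 0 < w) (hwx : w ≤ x * √DD) {c : ℝ × ℝ} (hc1 : 0 ≤ c.1) (hc2 : 0 < c.2)
    (hbudget : c.1 + p * c.2 ≤ w) : UBf DD c ≤ UBf DD (0, w / p) := by
  have hpc := mul_pos hp hc2
  have hs1 : c.1 / w < 1 := by rw [div_lt_one hw]; linarith
  have hcorner := corner_share_optimal_of_g_eq_zero hx hg (div_nonneg hc1 hw.le) hs1
  have hlog : Real.log c.2 ≤ Real.log (w / p) + Real.log (1 - c.1 / w) := by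
    rw [← Real.log_mul (by positivity) (by linarith)]
    refine Real.log_le_log hc2 ?_
    rw [show w / p * (1 - c.1 / w) = (w - c.1) / p by field_simp, le_div_iff₀ hp]
    linarith
  have hw2 : w ^ 2 ≤ DD * x ^ 2 := by
    calc w ^ 2 ≤ (x * √DD) ^ 2 := by gcongr
      _ = DD * x ^ 2 := by rw [mul_pow, Real.sq_sqrt hD.le]; ring
  have hc : c.1 ^ 2 ≤ DD * x ^ 2 * (c.1 / w) ^ 2 := by
    calc c.1 ^ 2 = w ^ 2 * (c.1 / w) ^ 2 := by field_simp
      _ ≤ _ := by gcongr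
  have hlogD := mul_le_mul_of_nonneg_left hlog hD.le
  have hcornerD := mul_nonpos_of_nonneg_of_nonpos hD.le hcorner
  simp only [UBf]
  linarith

/-- if there is `p > 0` with `cA1 p = e^A₁ + e^B₁` and
`e^B₁ + p e^B₂ < x* √D`, then an equilibrium with `c^B₁ = 0` and relative price
`p₂/p₁ = p` exists. -/
theorem corner_equilibrium_exists (UA : ℝ × ℝ → ℝ) (DD eA1 eA2 eB1 eB2 xs : ℝ)
(heA1 : 0 < eA1) (heA2 : 0 < eA2) (heB1 : 0 < eB1) (heB2 : 0 < eB2) (hD : 0 < DD)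
    (hxs2 : 2 < xs) (hxs0 : g xs = 0)
    (hUAc : ContinuousOn UA {c : ℝ × ℝ | 0 ≤ c.1 ∧ 0 ≤ c.2})
    (hUA1 : ∀ a b d : ℝ, 0 ≤ a → 0 ≤ d → a < b → UA (a, d) < UA (b, d))
    (hUA2 : ∀ a d d' : ℝ, 0 ≤ a → 0 ≤ d → d < d' → UA (a, d) < UA (a, d'))
    (cA1 cA2 : ℝ → ℝ)
    (hdem : ∀ p : ℝ, 0 < p →
      {c : ℝ × ℝ | (0 ≤ c.1 ∧ 0 ≤ c.2 ∧ c.1 + p*c.2 ≤ eA1 + p*eA2) ∧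
        ∀ c' : ℝ × ℝ, 0 ≤ c'.1 → 0 ≤ c'.2 → c'.1 + p*c'.2 ≤ eA1 + p*eA2 → UA c' ≤ UA c}
        = {(cA1 p, cA2 p)})
    (p : ℝ) (hp : 0 < p)
    (h1 : cA1 p = eA1 + eB1)
    (h2 : eB1 + p*eB2 < xs * Real.sqrt DD) :
    ∃ p1 p2 : ℝ, ∃ cA cB : ℝ × ℝ,
      IsEquil UA DD eA1 eA2 eB1 eB2 p1 p2 cA cB ∧ cB.1 = 0 ∧ p2/p1 = p := by
  have hmem : (cA1 p, cA2 p) ∈ ({(cA1 p, cA2 p)} : Set (ℝ × ℝ)) := rfl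
  rw [← hdem p hp] at hmem
  obtain ⟨⟨hA1, hA2, hbudget⟩, hmax⟩ := hmem
  simp only at hA1 hA2 hbudget hmax
  have hbinding : cA1 p + p * cA2 p = eA1 + p * eA2 := by
    by_contra hne
    have hslack := lt_of_le_of_ne hbudget hne
    have hbetter := hUA1 (cA1 p) (eA1 + p * eA2 - p * cA2 p) (cA2 p) hA1 hA2 (by linarith)
    have hle := hmax (eA1 + p * eA2 - p * cA2 p, cA2 p) (by simp only; linarith) hA2
      (by simp only; linarith)
    linarith
  have hw : 0 < eB1 + p * eB2 := by positivity
  refine ⟨1, p, (cA1 p, cA2 p), (0, (eB1 + p * eB2) / p), ⟨one_pos, hp, ⟨hA1, hA2, ?_⟩, ?_,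
    ⟨le_rfl, div_pos hw hp, ?_⟩, ?_, ?_, ?_⟩, rfl, div_one p⟩
  · simpa only [one_mul] using hbudget
  · simpa only [one_mul] using hmax
  · simp only [mul_zero, zero_add, one_mul]
    rw [mul_div_cancel₀ _ hp.ne']
  · intro c hc1 hc2 hc
    exact UBf_le_corner hD hxs2 hxs0 hp hw h2.le hc1 hc2 (by simpa only [one_mul] using hc)
  · simpa only [add_zero] using h1
  · simp only
    field_simp
    linarith
end

section
/- Consider a two-good, two-agent exchange economy with endowments e^A₁, e^A₂, e^B₁, e^B₂ > 0, where agent A's utility U^A is continuous and strictly increasing in each component and for every p > 0 admits a unique demand (c^A₁(p), c^A₂(p)) over the budget set {(c₁,c₂) : c₁, c₂ ≥ 0, c₁ + p·c₂ ≤ e^A₁ + p·e^A₂}, and agent B has utility U^B(c₁,c₂) = c₁²/2 + D·ln c₂ with D > 0. If there exists p > 0 such that, writing m = e^B₁ + p·e^B₂, one has c^A₁(p) + (m + √(m² − 4D))/2 = e^A₁ + e^B₁ and m > x*·√D, then there exists an equilibrium with c^B₁ > 0 and relative price p₂/p₁ = p. -/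
/-- In the parametrization `x = a + a⁻¹`, the function `g` takes a simple form. -/
lemma g_add_inv {a : ℝ} (ha : 1 < a) : g (a + a⁻¹) = a ^ 2 / 2 - Real.log (1 + a ^ 2) := by
  have ha0 : 0 < a := by linarith
  have hinv : a⁻¹ < 1 := inv_lt_one_of_one_lt₀ ha
  have hs1 : Real.sqrt ((a + a⁻¹) ^ 2 - 4) = a - a⁻¹ := by
    rw [show (a + a⁻¹) ^ 2 - 4 = (a - a⁻¹) ^ 2 by field_simp; ring]
    exact Real.sqrt_sq (by linarith)
  have hs2 : Real.sqrt (1 - 4 / (a + a⁻¹) ^ 2) = (a ^ 2 - 1) / (1 + a ^ 2) := by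
    rw [show 1 - 4 / (a + a⁻¹) ^ 2 = ((a ^ 2 - 1) / (1 + a ^ 2)) ^ 2 by field_simp; ring]
    exact Real.sqrt_sq (div_nonneg (by nlinarith) (by positivity))
  have hlog : 1 - (a ^ 2 - 1) / (1 + a ^ 2) = 2 / (1 + a ^ 2) := by field_simp; ring
  rw [g, hs1, hs2, hlog, Real.log_div (by norm_num) (by positivity)]
  ring

/-- `w ↦ (w - 1) / 2 - log w` is monotone on `[2, ∞)`. -/
lemma half_sub_log_le {v w : ℝ} (hv : 2 ≤ v) (hvw : v ≤ w) :
    (v - 1) / 2 - Real.log v ≤ (w - 1) / 2 - Real.log w := by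
  have hlog := Real.log_le_sub_one_of_pos (show 0 < w / v by apply div_pos <;> linarith)
  rw [Real.log_div (by linarith) (by linarith)] at hlog
  have : w / v - 1 ≤ (w - v) / 2 := by
    rw [div_sub_one (by linarith)]
    exact div_le_div_of_nonneg_left (by linarith) (by norm_num) hv
  linarith

/-- If `g` vanishes at `x > 2`, then `log (1 + r²) ≤ r² / 2` for every `r` at least the larger
root of `t² - x t + 1`. -/
lemma log_one_add_sq_le {x r : ℝ} (hx : 2 < x) (hg : g x = 0)
    (hr : (x + Real.sqrt (x ^ 2 - 4)) / 2 ≤ r) : Real.log (1 + r ^ 2) ≤ r ^ 2 / 2 := by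
  set s := Real.sqrt (x ^ 2 - 4)
  have hs : s ^ 2 = x ^ 2 - 4 := Real.sq_sqrt (by nlinarith)
  have hs0 : 0 ≤ s := Real.sqrt_nonneg _
  set a := (x + s) / 2 with ha
  have ha1 : 1 < a := by linarith
  have hinv : a⁻¹ = (x - s) / 2 := inv_eq_of_mul_eq_one_right (by rw [ha]; linarith)
  have hxa : x = a + a⁻¹ := by rw [hinv, ha]; ring
  rw [hxa, g_add_inv ha1] at hg
  have := half_sub_log_le (v := 1 + a ^ 2) (w := 1 + r ^ 2) (by nlinarith) (by gcongr)
  linarith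

/-- The derivative of utility along the budget line, whose critical points are `a` and `b`. -/
lemma hasDerivAt_budget_utility {a b t : ℝ} (ht : t < a + b) :
    HasDerivAt (fun t => t ^ 2 / 2 + a * b * Real.log (a + b - t))
      ((t - b) * (a - t) / (a + b - t)) t := by
  have hne : a + b - t ≠ 0 := by linarith
  have := (((hasDerivAt_id t).pow 2).div_const 2).add
    ((((hasDerivAt_id t).const_sub (a + b)).log hne).const_mul (a * b))
  refine this.congr_deriv ?_
  simp only [id_eq]
  field_simp
  ring

/-- On the budget line, utility is maximized at the corner `0` or at the critical point `a`. -/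
lemma budget_utility_le {a b t : ℝ} (hb : 0 < b) (hba : b ≤ a)
    (hcorner : a * b * Real.log (a + b) ≤ a ^ 2 / 2 + a * b * Real.log b)
    (ht0 : 0 ≤ t) (ht : t < a + b) :
    t ^ 2 / 2 + a * b * Real.log (a + b - t) ≤ a ^ 2 / 2 + a * b * Real.log b := by
  set f : ℝ → ℝ := fun t => t ^ 2 / 2 + a * b * Real.log (a + b - t) with hf
  have hd : ∀ t < a + b, HasDerivAt f ((t - b) * (a - t) / (a + b - t)) t :=
    fun t ht => hasDerivAt_budget_utility ht
  have hfa : f a = a ^ 2 / 2 + a * b * Real.log b := by simp [hf]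
  have hf0 : f 0 = a * b * Real.log (a + b) := by simp [hf]
  rw [← hfa, ← hf0] at hcorner
  rw [← hfa]
  change f t ≤ f a
  rcases le_total t b with htb | hbt
  · refine le_trans ?_ hcorner
    refine antitoneOn_of_hasDerivWithinAt_nonpos (convex_Icc 0 b)
      (fun x hx => (hd x (by linarith [hx.2])).continuousAt.continuousWithinAt)
      (fun x hx => (hd x ?_).hasDerivWithinAt) (fun x hx => ?_) ⟨le_rfl, hb.le⟩ ⟨ht0, htb⟩ ht0
    all_goals rw [interior_Icc] at hx; obtain ⟨h0, h1⟩ := hx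
    · linarith
    · exact div_nonpos_of_nonpos_of_nonneg
        (mul_nonpos_of_nonpos_of_nonneg (by linarith) (by linarith)) (by linarith)
  rcases le_total t a with hta | hat
  · refine monotoneOn_of_hasDerivWithinAt_nonneg (convex_Icc b a)
      (fun x hx => (hd x (by linarith [hx.2])).continuousAt.continuousWithinAt)
      (fun x hx => (hd x ?_).hasDerivWithinAt) (fun x hx => ?_) ⟨hbt, hta⟩ ⟨hba, le_rfl⟩ hta
    all_goals rw [interior_Icc] at hx; obtain ⟨h0, h1⟩ := hx
    · linarith
    · exact div_nonneg (mul_nonneg (by linarith) (by linarith)) (by linarith)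
  · refine antitoneOn_of_hasDerivWithinAt_nonpos (convex_Icc a t)
      (fun x hx => (hd x (by linarith [hx.2])).continuousAt.continuousWithinAt)
      (fun x hx => (hd x ?_).hasDerivWithinAt) (fun x hx => ?_) ⟨le_rfl, hat⟩ ⟨hat, le_rfl⟩ hat
    all_goals rw [interior_Icc] at hx; obtain ⟨h0, h1⟩ := hx
    · linarith
    · exact div_nonpos_of_nonpos_of_nonneg
        (mul_nonpos_of_nonneg_of_nonpos (by linarith) (by linarith)) (by linarith)

/-- Agent B's optimal bundle at relative price `p`, where `a ≥ b > 0` are the roots of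
`t² - m t + D` and `m = a + b` is the value of the endowment. -/
lemma UBf_le_of_budget {a b p : ℝ} {c : ℝ × ℝ} (hp : 0 < p) (hb : 0 < b) (hba : b ≤ a)
    (hcorner : a * b * Real.log (a + b) ≤ a ^ 2 / 2 + a * b * Real.log b)
    (hc1 : 0 ≤ c.1) (hc2 : 0 < c.2) (hc : c.1 + p * c.2 ≤ a + b) :
    UBf (a * b) c ≤ UBf (a * b) (a, b / p) := by
  have hpc : 0 < p * c.2 := mul_pos hp hc2
  have hD : 0 ≤ a * b := mul_nonneg (by linarith) hb.le
  have hmax := budget_utility_le hb hba hcorner hc1 (by linarith)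
  have hlog : Real.log (p * c.2) ≤ Real.log (a + b - c.1) :=
    Real.log_le_log hpc (by linarith)
  rw [Real.log_mul hp.ne' hc2.ne'] at hlog
  have := mul_le_mul_of_nonneg_left hlog hD
  simp only [UBf]
  rw [Real.log_div hb.ne' hp.ne']
  linarith

/-- if there is `p > 0` with, writing `m = e^B₁ + p e^B₂`,
`cA1 p + (m + √(m² − 4D))/2 = e^A₁ + e^B₁` and `m > x* √D`, then an equilibrium with
`c^B₁ > 0` and relative price `p₂/p₁ = p` exists. -/
theorem interior_equilibrium_exists (UA : ℝ × ℝ → ℝ) (DD eA1 eA2 eB1 eB2 xs : ℝ)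
(heA1 : 0 < eA1) (heA2 : 0 < eA2) (heB1 : 0 < eB1) (heB2 : 0 < eB2) (hD : 0 < DD)
    (hxs2 : 2 < xs) (hxs0 : g xs = 0)
    (hUAc : ContinuousOn UA {c : ℝ × ℝ | 0 ≤ c.1 ∧ 0 ≤ c.2})
    (hUA1 : ∀ a b d : ℝ, 0 ≤ a → 0 ≤ d → a < b → UA (a, d) < UA (b, d))
    (hUA2 : ∀ a d d' : ℝ, 0 ≤ a → 0 ≤ d → d < d' → UA (a, d) < UA (a, d'))
    (cA1 cA2 : ℝ → ℝ)
    (hdem : ∀ p : ℝ, 0 < p →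
      {c : ℝ × ℝ | (0 ≤ c.1 ∧ 0 ≤ c.2 ∧ c.1 + p*c.2 ≤ eA1 + p*eA2) ∧
        ∀ c' : ℝ × ℝ, 0 ≤ c'.1 → 0 ≤ c'.2 → c'.1 + p*c'.2 ≤ eA1 + p*eA2 → UA c' ≤ UA c}
        = {(cA1 p, cA2 p)})
    (p : ℝ) (hp : 0 < p)
    (h1 : cA1 p + (eB1 + p*eB2 + Real.sqrt ((eB1 + p*eB2)^2 - 4*DD))/2 = eA1 + eB1)
    (h2 : xs * Real.sqrt DD < eB1 + p*eB2) :
    ∃ p1 p2 : ℝ, ∃ cA cB : ℝ × ℝ,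
      IsEquil UA DD eA1 eA2 eB1 eB2 p1 p2 cA cB ∧ 0 < cB.1 ∧ p2/p1 = p := by
  obtain ⟨⟨hA1, hA2, hAb⟩, hAmax⟩ : (cA1 p, cA2 p) ∈ {c : ℝ × ℝ |
      (0 ≤ c.1 ∧ 0 ≤ c.2 ∧ c.1 + p*c.2 ≤ eA1 + p*eA2) ∧
        ∀ c' : ℝ × ℝ, 0 ≤ c'.1 → 0 ≤ c'.2 → c'.1 + p*c'.2 ≤ eA1 + p*eA2 → UA c' ≤ UA c} := by
    rw [hdem p hp]; rfl
  dsimp only at hA1 hA2 hAb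
  have hwalras : cA1 p + p * cA2 p = eA1 + p * eA2 := by
    refine le_antisymm hAb (not_lt.mp fun hlt => ?_)
    have hbetter := hUA1 (cA1 p) (eA1 + p * eA2 - p * cA2 p) (cA2 p) hA1 hA2 (by linarith)
    exact absurd (hAmax (eA1 + p * eA2 - p * cA2 p, cA2 p) (by dsimp only; linarith) hA2
      (by dsimp only; linarith)) hbetter.not_ge
  set m := eB1 + p * eB2 with hm
  set q := Real.sqrt DD
  have hq : 0 < q := Real.sqrt_pos.mpr hD
  have hqq : q ^ 2 = DD := Real.sq_sqrt hD.le
  have hmpos : 0 < m := by positivity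
  have hm2 : (xs * q) ^ 2 < m ^ 2 := by gcongr
  have hxs4 : 4 < xs ^ 2 := by nlinarith
  have hdisc : (xs ^ 2 - 4) * DD < m ^ 2 - 4 * DD := by rw [mul_pow, hqq] at hm2; linarith
  have hdisc0 : 0 < m ^ 2 - 4 * DD := lt_trans (mul_pos (by linarith) hD) hdisc
  set s := Real.sqrt (m ^ 2 - 4 * DD)
  have hs : s ^ 2 = m ^ 2 - 4 * DD := Real.sq_sqrt hdisc0.le
  have hs0 : 0 ≤ s := Real.sqrt_nonneg _
  have hsm : s < m := lt_of_pow_lt_pow_left₀ 2 hmpos.le (by linarith)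
  have hroot : Real.sqrt (xs ^ 2 - 4) * q ≤ s := by
    rw [← Real.sqrt_mul (by linarith)]
    exact Real.sqrt_le_sqrt hdisc.le
  obtain ⟨a, ha⟩ : ∃ a, a = (m + s) / 2 := ⟨_, rfl⟩
  obtain ⟨b, hb⟩ : ∃ b, b = (m - s) / 2 := ⟨_, rfl⟩
  have hb0 : 0 < b := by linarith
  have hba : b ≤ a := by linarith
  have ha0 : 0 < a := by linarith
  have hab : a * b = DD := by rw [ha, hb]; linarith
  have habm : a + b = m := by rw [ha, hb]; ring
  have hcorner : a * b * Real.log (a + b) ≤ a ^ 2 / 2 + a * b * Real.log b := by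
    have hlog := log_one_add_sq_le (r := a / q) hxs2 hxs0 (by
      rw [le_div_iff₀ hq, ha]; linarith)
    have hratio : (a / q) ^ 2 = a / b := by
      rw [div_pow, hqq, ← hab]; field_simp
    rw [hratio, one_add_div hb0.ne', Real.log_div (by linarith) hb0.ne', add_comm b a] at hlog
    have := mul_le_mul_of_nonneg_left hlog (mul_pos ha0 hb0).le
    have hcancel : a * b * (a / b / 2) = a ^ 2 / 2 := by field_simp
    linarith
  have hpb : p * (b / p) = b := mul_div_cancel₀ b hp.ne'
  refine ⟨1, p, (cA1 p, cA2 p), (a, b / p), ⟨one_pos, hp, ?_, ?_, ?_, ?_, ?_, ?_⟩, ha0, div_one p⟩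
  · exact ⟨hA1, hA2, by dsimp only; linarith⟩
  · exact fun c hc1 hc2 hc => hAmax c hc1 hc2 (by linarith)
  · exact ⟨ha0.le, div_pos hb0 hp, by dsimp only; linarith⟩
  · intro c hc1 hc2 hc
    rw [← hab]
    exact UBf_le_of_budget hp hb0 hba hcorner hc1 hc2 (by linarith)
  · dsimp only
    linarith
  · refine mul_left_cancel₀ hp.ne' ?_
    dsimp only
    linarith
end

section
/- Consider a two-good, two-agent exchange economy with endowments e^A₁, e^A₂, e^B₁, e^B₂ > 0, where agent A's utility U^A is continuous and strictly increasing in each component and for every p > 0 admits a unique demand (c^A₁(p), c^A₂(p)) over the budget set {(c₁,c₂) : c₁, c₂ ≥ 0, c₁ + p·c₂ ≤ e^A₁ + p·e^A₂}, and agent B has utility U^B(c₁,c₂) = c₁²/2 + D·ln c₂ with D > 0. Suppose (a) there is no p > 0 with c^A₁(p) = e^A₁ + e^B₁ and e^B₁ + p·e^B₂ ≤ x*·√D, and (b) there is no p > 0 with c^A₁(p) + (m + √(m² − 4D))/2 = e^A₁ + e^B₁ and m ≥ x*·√D, where m = e^B₁ + p·e^B₂. Then no equilibrium exists. -/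
/-- The utility gain, in units of `D`, of the interior critical point `y√D` over the corner,
as a function of `t = y ^ 2`. -/
noncomputable def cornerGain (t : ℝ) : ℝ := t / 2 - Real.log (1 + t)

lemma cornerGain_neg {t : ℝ} (h0 : 0 < t) (h1 : t ≤ 1) : cornerGain t < 0 := by
  have hlog := Real.log_lt_sub_one_of_pos (x := (1 + t)⁻¹) (by positivity)
    (by simpa using h0.ne')
  have hfrac : (1 + t)⁻¹ - 1 ≤ -(t / 2) := by
    have : (1 + t)⁻¹ - 1 + t / 2 = t * (t - 1) / (2 * (1 + t)) := by field_simp; ring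
    have : t * (t - 1) / (2 * (1 + t)) ≤ 0 :=
      div_nonpos_of_nonpos_of_nonneg (by nlinarith) (by positivity)
    linarith
  rw [Real.log_inv] at hlog
  unfold cornerGain
  linarith

lemma strictMonoOn_cornerGain : StrictMonoOn cornerGain (Set.Ici 1) := by
  intro s hs t _ hst
  have hs1 : (1 : ℝ) ≤ s := hs
  have hlog := Real.log_lt_sub_one_of_pos (x := (1 + t) / (1 + s))
    (div_pos (by linarith) (by linarith))
    (by rw [ne_eq, div_eq_one_iff_eq (by linarith)]; intro h; linarith)
  rw [Real.log_div (by linarith) (by linarith)] at hlog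
  have hfrac : (1 + t) / (1 + s) - 1 ≤ (t - s) / 2 := by
    rw [div_sub_one (by linarith), div_le_div_iff₀ (by linarith) (by norm_num)]
    nlinarith
  unfold cornerGain
  linarith

lemma strictMonoOn_add_inv : StrictMonoOn (fun y : ℝ => y + y⁻¹) (Set.Ici 1) := by
  intro a ha b _ hab
  have ha1 : (1 : ℝ) ≤ a := ha
  have hb : 1 < b := by linarith
  have hdiff : b + b⁻¹ - (a + a⁻¹) = (b - a) * (a * b - 1) / (a * b) := by
    field_simp; ring
  have : 0 < (b - a) * (a * b - 1) / (a * b) :=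
    div_pos (mul_pos (by linarith) (by nlinarith)) (by nlinarith)
  change a + a⁻¹ < b + b⁻¹
  linarith

lemma exists_one_lt_add_inv_eq {x : ℝ} (hx : 2 < x) : ∃ y : ℝ, 1 < y ∧ y + y⁻¹ = x := by
  have hsq : Real.sqrt (x ^ 2 - 4) ^ 2 = x ^ 2 - 4 := Real.sq_sqrt (by nlinarith)
  have hnn := Real.sqrt_nonneg (x ^ 2 - 4)
  refine ⟨(x + Real.sqrt (x ^ 2 - 4)) / 2, by linarith, ?_⟩
  have : x + Real.sqrt (x ^ 2 - 4) ≠ 0 := by linarith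
  field_simp
  linarith

lemma g_add_inv_s7 {y : ℝ} (hy : 1 < y) : g (y + y⁻¹) = cornerGain (y ^ 2) := by
  have hy0 : 0 < y := by linarith
  have hinv : y⁻¹ < 1 := inv_lt_one_of_one_lt₀ hy
  have h1 : Real.sqrt ((y + y⁻¹) ^ 2 - 4) = y - y⁻¹ := by
    rw [show (y + y⁻¹) ^ 2 - 4 = (y - y⁻¹) ^ 2 by field_simp; ring]
    exact Real.sqrt_sq (by linarith)
  have h2 : Real.sqrt (1 - 4 / (y + y⁻¹) ^ 2) = (y ^ 2 - 1) / (y ^ 2 + 1) := by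
    rw [show 1 - 4 / (y + y⁻¹) ^ 2 = ((y ^ 2 - 1) / (y ^ 2 + 1)) ^ 2 by
      field_simp; ring]
    exact Real.sqrt_sq (div_nonneg (by nlinarith) (by positivity))
  have h3 : 1 - (y ^ 2 - 1) / (y ^ 2 + 1) = 2 / (1 + y ^ 2) := by field_simp; ring
  unfold g cornerGain
  rw [h1, h2, h3, Real.log_div (by norm_num) (by positivity)]
  ring

lemma UBf_critical_sub_corner {s m p y : ℝ} (hs : 0 < s) (hp : 0 < p) (hy : 0 < y)
    (hm : m = s * (y + y⁻¹)) :
    UBf (s ^ 2) (s * y, (m - s * y) / p) - UBf (s ^ 2) (0, m / p)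
      = s ^ 2 * cornerGain (y ^ 2) := by
  have h1 : (m - s * y) / p = m / p / (1 + y ^ 2) := by rw [hm]; field_simp; ring
  have hm0 : m / p ≠ 0 := by rw [hm]; positivity
  unfold UBf cornerGain
  simp only [h1]
  rw [Real.log_div hm0 (by positivity)]
  ring

lemma first_order_condition {D m p x : ℝ} (hp : 0 < p) (hx : 0 < x) (hxm : x < m)
    (hmax : ∀ z, 0 ≤ z → z < m → UBf D (z, (m - z) / p) ≤ UBf D (x, (m - x) / p)) :
    x * (m - x) = D := by
  have hloc : IsLocalMax (fun z => UBf D (z, (m - z) / p)) x := by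
    filter_upwards [Ioo_mem_nhds hx hxm] with z hz using hmax z hz.1.le hz.2
  have hmx : 0 < m - x := by linarith
  have hlin : HasDerivAt (fun z : ℝ => (m - z) / p) (-1 / p) x :=
    ((hasDerivAt_id x).const_sub m).div_const p
  have hder := (((hasDerivAt_id x).pow 2).div_const 2).add
    ((hlin.log (div_pos hmx hp).ne').const_mul D)
  have h0 := hloc.hasDerivAt_eq_zero hder
  simp only [id] at h0
  field_simp at h0
  norm_num at h0
  linarith

/-- Agent B's optimal demand for good 1 with price `p` and income `m` is the corner when
`m ≤ q√D`, or the larger critical point when `q√D ≤ m`, where `q` is the zero of `g`. -/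
lemma demand_corner_or_interior {D m p x q : ℝ} (hD : 0 < D) (hp : 0 < p) (hq : 2 < q)
    (hgq : g q = 0) (hx : 0 ≤ x) (hxm : x < m)
    (hmax : ∀ z, 0 ≤ z → z < m → UBf D (z, (m - z) / p) ≤ UBf D (x, (m - x) / p)) :
    (x = 0 ∧ m ≤ q * Real.sqrt D) ∨
      (x = (m + Real.sqrt (m ^ 2 - 4 * D)) / 2 ∧ q * Real.sqrt D ≤ m) := by
  obtain ⟨s, hs, rfl⟩ : ∃ s : ℝ, 0 < s ∧ D = s ^ 2 :=
    ⟨Real.sqrt D, Real.sqrt_pos.2 hD, (Real.sq_sqrt hD.le).symm⟩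
  rw [Real.sqrt_sq hs.le]
  obtain ⟨r, hr, rfl⟩ := exists_one_lt_add_inv_eq hq
  rw [g_add_inv_s7 hr] at hgq
  have hr2 : 1 < r ^ 2 := by nlinarith
  rcases hx.eq_or_lt with rfl | hx0
  · refine Or.inl ⟨rfl, ?_⟩
    by_contra! hlt
    have hq' : r + r⁻¹ < m / s := by rwa [lt_div_iff₀ hs]
    obtain ⟨y, hy, hym⟩ := exists_one_lt_add_inv_eq (hq.trans hq')
    have hm : m = s * (y + y⁻¹) := by rw [hym]; field_simp
    have hy0 : 0 < y := by linarith
    have hry : r < y :=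
      (strictMonoOn_add_inv.lt_iff_lt (Set.mem_Ici.2 hr.le) (Set.mem_Ici.2 hy.le)).1
        (by simpa only [hym] using hq')
    have hpos : 0 < cornerGain (y ^ 2) := by
      rw [← hgq]
      exact strictMonoOn_cornerGain (Set.mem_Ici.2 hr2.le)
        (Set.mem_Ici.2 (by nlinarith)) (by nlinarith)
    have hle := hmax (s * y) (by positivity) (by
      rw [hm]
      exact mul_lt_mul_of_pos_left (lt_add_of_pos_right y (inv_pos.2 hy0)) hs)
    have hgain := UBf_critical_sub_corner hs hp hy0 hm
    rw [sub_zero] at hle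
    have : 0 < s ^ 2 * cornerGain (y ^ 2) := by positivity
    linarith
  · have hfoc := first_order_condition hp hx0 hxm hmax
    obtain ⟨y, hy0, rfl⟩ : ∃ y : ℝ, 0 < y ∧ x = s * y :=
      ⟨x / s, by positivity, by field_simp⟩
    have hm : m = s * (y + y⁻¹) := by
      field_simp
      apply mul_left_cancel₀ hs.ne'
      linarith
    have hgain := UBf_critical_sub_corner hs hp hy0 hm
    have hle := hmax 0 le_rfl (by linarith)
    rw [sub_zero] at hle
    have hnn : 0 ≤ cornerGain (y ^ 2) :=
      nonneg_of_mul_nonneg_right (by linarith) (pow_pos hs 2)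
    have hy2 : 1 < y ^ 2 := by
      by_contra! h
      linarith [cornerGain_neg (by positivity) h]
    have hy : 1 < y := by nlinarith
    have hry : r ≤ y := by
      have := (strictMonoOn_cornerGain.le_iff_le (Set.mem_Ici.2 hr2.le)
        (Set.mem_Ici.2 hy2.le)).1 (hgq.trans_le hnn)
      exact (pow_le_pow_iff_left₀ (by linarith) hy0.le two_ne_zero).1 this
    have hqy : r + r⁻¹ ≤ y + y⁻¹ :=
      (strictMonoOn_add_inv.le_iff_le (Set.mem_Ici.2 hr.le) (Set.mem_Ici.2 hy.le)).2 hry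
    refine Or.inr ⟨?_, by rw [hm]; nlinarith⟩
    have hinv : y⁻¹ < 1 := inv_lt_one_of_one_lt₀ hy
    rw [hm, show (s * (y + y⁻¹)) ^ 2 - 4 * s ^ 2 = (s * (y - y⁻¹)) ^ 2 by field_simp; ring,
      Real.sqrt_sq (mul_nonneg hs.le (by linarith))]
    ring

/-- if neither the corner equation nor the interior equation has a solution
(in the sense below), then no equilibrium exists. -/
theorem no_equilibrium (UA : ℝ × ℝ → ℝ) (DD eA1 eA2 eB1 eB2 xs : ℝ)
(heA1 : 0 < eA1) (heA2 : 0 < eA2) (heB1 : 0 < eB1) (heB2 : 0 < eB2) (hD : 0 < DD)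
    (hxs2 : 2 < xs) (hxs0 : g xs = 0)
    (hUAc : ContinuousOn UA {c : ℝ × ℝ | 0 ≤ c.1 ∧ 0 ≤ c.2})
    (hUA1 : ∀ a b d : ℝ, 0 ≤ a → 0 ≤ d → a < b → UA (a, d) < UA (b, d))
    (hUA2 : ∀ a d d' : ℝ, 0 ≤ a → 0 ≤ d → d < d' → UA (a, d) < UA (a, d'))
    (cA1 cA2 : ℝ → ℝ)
    (hdem : ∀ p : ℝ, 0 < p →
      {c : ℝ × ℝ | (0 ≤ c.1 ∧ 0 ≤ c.2 ∧ c.1 + p*c.2 ≤ eA1 + p*eA2) ∧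
        ∀ c' : ℝ × ℝ, 0 ≤ c'.1 → 0 ≤ c'.2 → c'.1 + p*c'.2 ≤ eA1 + p*eA2 → UA c' ≤ UA c}
        = {(cA1 p, cA2 p)})
    (ha : ¬ ∃ p : ℝ, 0 < p ∧ cA1 p = eA1 + eB1 ∧ eB1 + p*eB2 ≤ xs * Real.sqrt DD)
    (hb : ¬ ∃ p : ℝ, 0 < p ∧
      cA1 p + (eB1 + p*eB2 + Real.sqrt ((eB1 + p*eB2)^2 - 4*DD))/2 = eA1 + eB1 ∧
      xs * Real.sqrt DD ≤ eB1 + p*eB2) :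
    ¬ ∃ p1 p2 : ℝ, ∃ cA cB : ℝ × ℝ,
      IsEquil UA DD eA1 eA2 eB1 eB2 p1 p2 cA cB := by
  rintro ⟨p1, p2, cA, ⟨x, c⟩, hp1, hp2, ⟨hA1, hA2, hAbud⟩, hAmax, ⟨hx, hc, hBbud⟩, hBmax,
    hclear, -⟩
  obtain ⟨p, hp, rfl⟩ : ∃ p : ℝ, 0 < p ∧ p2 = p1 * p :=
    ⟨p2 / p1, by positivity, by field_simp⟩
  have hbudget : ∀ a b e f : ℝ, p1 * a + p1 * p * b ≤ p1 * e + p1 * p * f ↔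
      a + p * b ≤ e + p * f := by
    intro a b e f
    rw [mul_assoc, mul_assoc, ← mul_add, ← mul_add, mul_le_mul_iff_right₀ hp1]
  simp only [hbudget] at hAbud hAmax hBbud hBmax hx hc hclear
  have hcA : cA = (cA1 p, cA2 p) := by
    have hmem : cA ∈ ({(cA1 p, cA2 p)} : Set (ℝ × ℝ)) := by
      rw [← hdem p hp]
      exact ⟨⟨hA1, hA2, hAbud⟩, hAmax⟩
    exact hmem
  subst hcA
  have hpc : 0 < p * c := mul_pos hp hc
  have hmax : ∀ z, 0 ≤ z → z < eB1 + p * eB2 →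
      UBf DD (z, (eB1 + p * eB2 - z) / p) ≤ UBf DD (x, (eB1 + p * eB2 - x) / p) := by
    intro z hz hzm
    refine (hBmax (z, (eB1 + p * eB2 - z) / p) hz (div_pos (by linarith) hp) ?_).trans ?_
    · field_simp
      linarith
    · have hle : c ≤ (eB1 + p * eB2 - x) / p := by
        rw [le_div_iff₀ hp]
        linarith
      have := mul_le_mul_of_nonneg_left (Real.log_le_log hc hle) hD.le
      simp only [UBf]
      linarith
  rcases demand_corner_or_interior hD hp hxs2 hxs0 hx (by linarith) hmax with
    ⟨rfl, hm⟩ | ⟨hxm, hm⟩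
  · exact ha ⟨p, hp, by linarith, hm⟩
  · exact hb ⟨p, hp, by rw [← hxm]; exact hclear, hm⟩
end

section
/- In the log–nonconvex economy, there exists an equilibrium with c^B₁ = 0 if and only if e^B₁ + e^B₂·(2e^B₁ + e^A₁)/e^A₂ ≤ x*·√D. Moreover, such an equilibrium is unique up to multiplying the prices by a positive scalar: its relative price is p₂/p₁ = π^cor = (2e^B₁ + e^A₁)/e^A₂, and its allocation is uniquely determined (in particular c^A₁ = e^A₁ + e^B₁). -/
/-- Equilibrium of the log–nonconvex economy: agent A has utility `ln c₁ + ln c₂`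
(on `c₁, c₂ > 0`), agent B has utility `c₁²/2 + D ln c₂` (on `c₁ ≥ 0, c₂ > 0`),
each maximizes on their budget set, and both markets clear. -/
def LogEquil (DD eA1 eA2 eB1 eB2 p1 p2 : ℝ) (cA cB : ℝ × ℝ) : Prop :=
  0 < p1 ∧ 0 < p2 ∧
  (0 < cA.1 ∧ 0 < cA.2 ∧ p1*cA.1 + p2*cA.2 ≤ p1*eA1 + p2*eA2) ∧
  (∀ c : ℝ × ℝ, 0 < c.1 → 0 < c.2 → p1*c.1 + p2*c.2 ≤ p1*eA1 + p2*eA2 →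
    Real.log c.1 + Real.log c.2 ≤ Real.log cA.1 + Real.log cA.2) ∧
  (0 ≤ cB.1 ∧ 0 < cB.2 ∧ p1*cB.1 + p2*cB.2 ≤ p1*eB1 + p2*eB2) ∧
  (∀ c : ℝ × ℝ, 0 ≤ c.1 → 0 < c.2 → p1*c.1 + p2*c.2 ≤ p1*eB1 + p2*eB2 →
    c.1^2/2 + DD*Real.log c.2 ≤ cB.1^2/2 + DD*Real.log cB.2) ∧
  cA.1 + cB.1 = eA1 + eB1 ∧ cA.2 + cB.2 = eA2 + eB2

/-- Cobb–Douglas demand with equal weights: expenditure is split evenly between the two goods. -/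
lemma log_demand {p1 p2 W a b : ℝ} (hp1 : 0 < p1) (hp2 : 0 < p2) (hW : 0 < W)
    (ha : 0 < a) (hb : 0 < b) (hbud : p1 * a + p2 * b ≤ W)
    (hopt : ∀ c : ℝ × ℝ, 0 < c.1 → 0 < c.2 → p1 * c.1 + p2 * c.2 ≤ W →
      Real.log c.1 + Real.log c.2 ≤ Real.log a + Real.log b) :
    p1 * a = W / 2 ∧ p2 * b = W / 2 := by
  have h := hopt (W / (2 * p1), W / (2 * p2)) (by positivity) (by positivity)
    (le_of_eq (by simp only; field_simp; norm_num))
  simp only at h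
  rw [← Real.log_mul (by positivity) (by positivity), ← Real.log_mul ha.ne' hb.ne',
    Real.log_le_log_iff (by positivity) (by positivity), div_mul_div_comm,
    div_le_iff₀ (by positivity)] at h
  have hsum : 0 < p1 * a + p2 * b := by positivity
  have hsq : (p1 * a - p2 * b) ^ 2 ≤ 0 := by nlinarith
  have heq : p1 * a = p2 * b :=
    sub_eq_zero.1 (pow_eq_zero_iff two_ne_zero |>.1 (le_antisymm hsq (sq_nonneg _)))
  have hge : W / 2 ≤ p1 * a := by
    have hpa : 0 < p1 * a := by positivity
    have : (W / 2) ^ 2 ≤ (p1 * a) ^ 2 := by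
      have : (p1 * a) ^ 2 = p1 * a * (p2 * b) := by rw [← heq]; ring
      nlinarith
    exact le_of_sq_le_sq this hpa.le
  constructor <;> linarith

/-- The even split of expenditure maximizes the sum of logarithms on the budget set. -/
lemma log_add_log_le_of_budget {p1 p2 a b x y : ℝ} (hp1 : 0 < p1) (hp2 : 0 < p2)
    (ha : 0 < a) (hb : 0 < b) (hab : p1 * a = p2 * b) (hx : 0 < x) (hy : 0 < y)
    (hbud : p1 * x + p2 * y ≤ p1 * a + p2 * b) :
    Real.log x + Real.log y ≤ Real.log a + Real.log b := by
  rw [← Real.log_mul hx.ne' hy.ne', ← Real.log_mul ha.ne' hb.ne']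
  refine Real.log_le_log (by positivity) ?_
  have hpos : 0 < p1 * x + p2 * y := by positivity
  have hsq : (p1 * x + p2 * y) ^ 2 ≤ (p1 * a + p2 * b) ^ 2 :=
    pow_le_pow_left₀ hpos.le hbud 2
  have hsq' : (p1 * a + p2 * b) ^ 2 = 4 * (p1 * a) * (p2 * b) := by rw [hab]; ring
  have : (p1 * p2) * (x * y) ≤ (p1 * p2) * (a * b) := by
    nlinarith [sq_nonneg (p1 * x - p2 * y)]
  exact le_of_mul_le_mul_left this (by positivity)

/-- Spending everything on good 2 is optimal for the nonconvex agent iff no expenditure share `s`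
on good 1 improves on it. -/
lemma corner_optimal_iff {D p1 p2 W : ℝ} (hD : 0 < D) (hp1 : 0 < p1) (hp2 : 0 < p2)
    (hW : 0 < W) :
    (∀ c : ℝ × ℝ, 0 ≤ c.1 → 0 < c.2 → p1 * c.1 + p2 * c.2 ≤ W →
      c.1 ^ 2 / 2 + D * Real.log c.2 ≤ D * Real.log (W / p2)) ↔
    ∀ s : ℝ, 0 ≤ s → s < 1 → (W / p1) ^ 2 * s ^ 2 / 2 + D * Real.log (1 - s) ≤ 0 := by
  constructor
  · intro h s hs0 hs1
    have hs : 0 < 1 - s := by linarith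
    have h' := h (W / p1 * s, W / p2 * (1 - s)) (by positivity) (by positivity)
      (le_of_eq (by simp only; field_simp; ring))
    simp only at h'
    rw [Real.log_mul (by positivity) hs.ne', mul_pow] at h'
    linarith
  · rintro h ⟨a, b⟩ ha hb hbud
    simp only at ha hb hbud ⊢
    have hpb : 0 < p2 * b := by positivity
    have hs1 : p1 * a / W < 1 := by rw [div_lt_one hW]; linarith
    have h' := h (p1 * a / W) (by positivity) hs1
    have hs : 0 < 1 - p1 * a / W := by linarith
    have hb' : b ≤ W / p2 * (1 - p1 * a / W) := by
      have : W / p2 * (1 - p1 * a / W) = (W - p1 * a) / p2 := by field_simp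
      rw [this, le_div_iff₀ hp2]
      linarith
    have hlog := Real.log_le_log hb hb'
    rw [Real.log_mul (by positivity) hs.ne'] at hlog
    have hsq : (W / p1) ^ 2 * (p1 * a / W) ^ 2 = a ^ 2 := by field_simp
    rw [hsq] at h'
    nlinarith

lemma hasDerivAt_share_gain (k : ℝ) {s : ℝ} (hs : s < 1) :
    HasDerivAt (fun s : ℝ => k * s ^ 2 / 2 + Real.log (1 - s)) (k * s - 1 / (1 - s)) s := by
  have h1 := (((hasDerivAt_id s).pow 2).const_mul k).div_const 2
  have h2 := ((hasDerivAt_id s).const_sub 1).log (by simp only [id]; linarith)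
  refine (h1.add h2).congr_deriv ?_
  simp only [id]
  ring

/-- If the gain `k s² / 2 + ln (1 - s)` vanishes at its larger critical point `s₀`, it is nowhere
positive on `[0, 1)`. -/
lemma share_gain_nonpos {k s₀ s : ℝ} (hs₀ : 1 / 2 < s₀) (hs₀' : s₀ < 1)
    (hk : k * (s₀ * (1 - s₀)) = 1) (hzero : k * s₀ ^ 2 / 2 + Real.log (1 - s₀) = 0)
    (hs : 0 ≤ s) (hs' : s < 1) : k * s ^ 2 / 2 + Real.log (1 - s) ≤ 0 := by
  set f : ℝ → ℝ := fun s => k * s ^ 2 / 2 + Real.log (1 - s) with hf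
  have hkpos : 0 < k := by
    have : 0 < s₀ * (1 - s₀) := mul_pos (by linarith) (by linarith)
    by_contra! hcon
    nlinarith
  have hcont : ContinuousOn f (Set.Iio 1) := fun x hx =>
    (hasDerivAt_share_gain k hx).continuousAt.continuousWithinAt
  have hfac : ∀ x : ℝ, x < 1 →
      k * x - 1 / (1 - x) = k * ((s₀ - x) * (x - (1 - s₀))) / (1 - x) := by
    intro x hx
    have : 1 - x ≠ 0 := by linarith
    rw [eq_div_iff this, sub_mul, div_mul_cancel₀ _ this]
    linear_combination hk
  have hderiv : ∀ x : ℝ, x < 1 → deriv f x = k * ((s₀ - x) * (x - (1 - s₀))) / (1 - x) :=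
    fun x hx => (hasDerivAt_share_gain k hx).deriv.trans (hfac x hx)
  rcases le_total s (1 - s₀) with h1 | h1
  · have hanti : AntitoneOn f (Set.Icc 0 (1 - s₀)) := by
      refine antitoneOn_of_deriv_nonpos (convex_Icc _ _)
        (hcont.mono fun x hx => by simp only [Set.mem_Iio]; linarith [hx.2])
        (fun x hx => ?_) (fun x hx => ?_)
      · rw [interior_Icc] at hx
        exact (hasDerivAt_share_gain k (by linarith [hx.2])).differentiableAt.differentiableWithinAt
      · rw [interior_Icc] at hx
        rw [hderiv x (by linarith [hx.2])]
        refine div_nonpos_of_nonpos_of_nonneg ?_ (by linarith [hx.2])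
        exact mul_nonpos_of_nonneg_of_nonpos hkpos.le
          (mul_nonpos_of_nonneg_of_nonpos (by linarith [hx.2]) (by linarith [hx.2]))
    have := hanti ⟨le_rfl, by linarith⟩ ⟨hs, h1⟩ hs
    simpa [hf] using this
  rcases le_total s s₀ with h2 | h2
  · have hmono : MonotoneOn f (Set.Icc (1 - s₀) s₀) := by
      refine monotoneOn_of_deriv_nonneg (convex_Icc _ _)
        (hcont.mono fun x hx => by simp only [Set.mem_Iio]; linarith [hx.2])
        (fun x hx => ?_) (fun x hx => ?_)
      · rw [interior_Icc] at hx
        exact (hasDerivAt_share_gain k (by linarith [hx.2])).differentiableAt.differentiableWithinAt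
      · rw [interior_Icc] at hx
        rw [hderiv x (by linarith [hx.2])]
        refine div_nonneg ?_ (by linarith [hx.2])
        exact mul_nonneg hkpos.le (mul_nonneg (by linarith [hx.2]) (by linarith [hx.1]))
    exact (hmono ⟨h1, h2⟩ ⟨by linarith, le_rfl⟩ h2).trans hzero.le
  · have hanti : AntitoneOn f (Set.Ico s₀ 1) := by
      refine antitoneOn_of_deriv_nonpos (convex_Ico _ _) (hcont.mono fun x hx => hx.2)
        (fun x hx => ?_) (fun x hx => ?_)
      · rw [interior_Ico] at hx
        exact (hasDerivAt_share_gain k hx.2).differentiableAt.differentiableWithinAt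
      · rw [interior_Ico] at hx
        rw [hderiv x hx.2]
        refine div_nonpos_of_nonpos_of_nonneg ?_ (by linarith [hx.2])
        exact mul_nonpos_of_nonneg_of_nonpos hkpos.le
          (mul_nonpos_of_nonpos_of_nonneg (by linarith [hx.1]) (by linarith [hx.1]))
    exact (hanti ⟨le_rfl, hs₀'⟩ ⟨h2, hs'⟩ h2).trans hzero.le

/-- A zero of `g` beyond `2` yields the larger critical point of the gain, with value zero. -/
lemma exists_critical_share {x : ℝ} (hx : 2 < x) (hg : g x = 0) :
    ∃ s₀ : ℝ, 1 / 2 < s₀ ∧ s₀ < 1 ∧ x ^ 2 * (s₀ * (1 - s₀)) = 1 ∧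
      x ^ 2 * s₀ ^ 2 / 2 + Real.log (1 - s₀) = 0 := by
  have hx0 : 0 < x := by linarith
  have hx4 : 4 < x ^ 2 := by nlinarith
  set r := Real.sqrt (1 - 4 / x ^ 2) with hr
  have hq : 0 < 1 - 4 / x ^ 2 := by
    have : 4 / x ^ 2 < 1 := by rw [div_lt_one (by positivity)]; exact hx4
    linarith
  have hr0 : 0 < r := Real.sqrt_pos.2 hq
  have hrsq : r ^ 2 = 1 - 4 / x ^ 2 := Real.sq_sqrt hq.le
  have hxr : x ^ 2 * r ^ 2 = x ^ 2 - 4 := by rw [hrsq]; field_simp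
  have hr1 : r < 1 := by
    have : 0 < 4 / x ^ 2 := by positivity
    nlinarith
  have hroot : Real.sqrt (x ^ 2 - 4) = x * r := by
    rw [← hxr, ← mul_pow, Real.sqrt_sq (by positivity)]
  refine ⟨(1 + r) / 2, by linarith, by linarith, by nlinarith, ?_⟩
  have hlog : Real.log (1 - (1 + r) / 2) = Real.log (1 - r) - Real.log 2 := by
    rw [← Real.log_div (by linarith) (by norm_num)]
    congr 1
    ring
  rw [g, hroot, ← hr] at hg
  rw [hlog]
  linear_combination hg

/-- With wealth `w` in units of good 1, no share on good 1 is improving iff `w ≤ x √D`,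
where `x` is the zero of `g`. -/
lemma share_gain_nonpos_iff {D w x : ℝ} (hD : 0 < D) (hw : 0 < w) (hx : 2 < x) (hg : g x = 0) :
    (∀ s : ℝ, 0 ≤ s → s < 1 → w ^ 2 * s ^ 2 / 2 + D * Real.log (1 - s) ≤ 0) ↔
      w ≤ x * Real.sqrt D := by
  obtain ⟨s₀, h1, h2, h3, h4⟩ := exists_critical_share hx hg
  have hxD : 0 ≤ x * Real.sqrt D := by positivity
  have hsq : (x * Real.sqrt D) ^ 2 = x ^ 2 * D := by rw [mul_pow, Real.sq_sqrt hD.le]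
  constructor
  · intro h
    have h5 := h s₀ (by linarith) h2
    have hlog : D * Real.log (1 - s₀) = -(D * (x ^ 2 * s₀ ^ 2 / 2)) := by
      linear_combination D * h4
    have h6 : w ^ 2 * s₀ ^ 2 ≤ (x ^ 2 * D) * s₀ ^ 2 := by linarith
    have h7 := le_of_mul_le_mul_right h6 (by positivity)
    exact le_of_sq_le_sq (hsq ▸ h7) hxD
  · intro h s hs hs'
    have h5 := mul_nonpos_of_nonneg_of_nonpos hD.le (share_gain_nonpos h1 h2 h3 h4 hs hs')
    have h6 : w ^ 2 ≤ x ^ 2 * D := hsq ▸ pow_le_pow_left₀ hw.le h 2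
    nlinarith [mul_le_mul_of_nonneg_right h6 (sq_nonneg s)]

/-- Prices and allocation of a corner equilibrium. -/
lemma LogEquil.corner_eq {D eA1 eA2 eB1 eB2 p1 p2 : ℝ} {cA cB : ℝ × ℝ}
    (heA1 : 0 < eA1) (heA2 : 0 < eA2) (h : LogEquil D eA1 eA2 eB1 eB2 p1 p2 cA cB)
    (h0 : cB.1 = 0) :
    p2 / p1 = (2 * eB1 + eA1) / eA2 ∧ cA.1 = eA1 + eB1 ∧
      (2 * eB1 + eA1) * cA.2 = eA2 * (eA1 + eB1) ∧
      p2 * cB.2 = p1 * eB1 + p2 * eB2 ∧ cA.2 + cB.2 = eA2 + eB2 := by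
  obtain ⟨hp1, hp2, ⟨ha, hb, hbud⟩, hopt, -, -, hm1, hm2⟩ := h
  obtain ⟨hA1, hA2⟩ := log_demand hp1 hp2 (by positivity) ha hb hbud hopt
  rw [h0, add_zero] at hm1
  rw [hm1] at hA1
  have hprice : p2 * eA2 = (2 * eB1 + eA1) * p1 := by linarith
  refine ⟨by rw [div_eq_div_iff hp1.ne' heA2.ne']; exact hprice, hm1, ?_, ?_, hm2⟩
  · refine mul_left_cancel₀ (mul_pos hp1 hp2).ne' ?_
    linear_combination -(p2 * cA.2) * hprice + p2 * eA2 * hA2 - p2 * eA2 * hA1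
  · linear_combination p2 * hm2 - hA2 + hA1 + hprice

/-- in the log–nonconvex economy, a corner equilibrium (`c^B₁ = 0`) exists
iff `e^B₁ + e^B₂ (2e^B₁+e^A₁)/e^A₂ ≤ x* √D`; it is unique up to price normalization, its
relative price is `π^cor = (2e^B₁+e^A₁)/e^A₂` and its allocation is uniquely determined
(in particular `c^A₁ = e^A₁ + e^B₁`). -/
theorem corner_equilibrium_iff (DD eA1 eA2 eB1 eB2 xs : ℝ)
    (heA1 : 0 < eA1) (heA2 : 0 < eA2) (heB1 : 0 < eB1) (heB2 : 0 < eB2) (hD : 0 < DD)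
    (hxs2 : 2 < xs) (hxs0 : g xs = 0) :
    ((∃ p1 p2 : ℝ, ∃ cA cB : ℝ × ℝ,
        LogEquil DD eA1 eA2 eB1 eB2 p1 p2 cA cB ∧ cB.1 = 0) ↔
      eB1 + eB2 * ((2*eB1 + eA1)/eA2) ≤ xs * Real.sqrt DD) ∧
    (∀ p1 p2 : ℝ, ∀ cA cB : ℝ × ℝ,
      LogEquil DD eA1 eA2 eB1 eB2 p1 p2 cA cB → cB.1 = 0 →
      p2/p1 = (2*eB1 + eA1)/eA2 ∧ cA.1 = eA1 + eB1) ∧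
    (∀ p1 p2 q1 q2 : ℝ, ∀ cA cB dA dB : ℝ × ℝ,
      LogEquil DD eA1 eA2 eB1 eB2 p1 p2 cA cB → cB.1 = 0 →
      LogEquil DD eA1 eA2 eB1 eB2 q1 q2 dA dB → dB.1 = 0 →
      cA = dA ∧ cB = dB) := by
  have hE : 0 < 2 * eB1 + eA1 := by positivity
  refine ⟨⟨?_, ?_⟩, ?_, ?_⟩
  · rintro ⟨p1, p2, cA, cB, h, h0⟩
    obtain ⟨hprice, -, -, hB, -⟩ := h.corner_eq heA1 heA2 h0
    obtain ⟨hp1, hp2, -, -, -, hopt, -, -⟩ := h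
    have hW : 0 < p1 * eB1 + p2 * eB2 := by positivity
    have hcB : cB.2 = (p1 * eB1 + p2 * eB2) / p2 := by
      rw [eq_div_iff hp2.ne', ← hB, mul_comm]
    have hw : (p1 * eB1 + p2 * eB2) / p1 = eB1 + eB2 * ((2 * eB1 + eA1) / eA2) := by
      rw [← hprice]
      field_simp
    rw [← hw, ← share_gain_nonpos_iff hD (by positivity) hxs2 hxs0,
      ← corner_optimal_iff hD hp1 hp2 hW]
    intro c h1 h2 h3
    simpa [h0, hcB] using hopt c h1 h2 h3
  · intro h
    set π := (2 * eB1 + eA1) / eA2 with hπ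
    have hπ0 : 0 < π := by positivity
    have hπe : π * eA2 = 2 * eB1 + eA1 := by rw [hπ]; field_simp
    have hW : 0 < 1 * eB1 + π * eB2 := by positivity
    have hgain := (share_gain_nonpos_iff hD (w := (1 * eB1 + π * eB2) / 1) (by positivity)
      hxs2 hxs0).2 (by linarith)
    have hopt := (corner_optimal_iff hD one_pos hπ0 hW).2 hgain
    have hA : π * ((eA1 + eB1) / π) = eA1 + eB1 := mul_div_cancel₀ _ hπ0.ne'
    have hB : π * ((1 * eB1 + π * eB2) / π) = 1 * eB1 + π * eB2 := mul_div_cancel₀ _ hπ0.ne'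
    refine ⟨1, π, (eA1 + eB1, (eA1 + eB1) / π), (0, (1 * eB1 + π * eB2) / π),
      ⟨one_pos, hπ0, ⟨by positivity, by positivity, by simp only; linarith⟩, ?_,
        ⟨le_rfl, by positivity, by simp only; linarith⟩, ?_, by simp, ?_⟩, rfl⟩
    · intro c h1 h2 h3
      exact log_add_log_le_of_budget one_pos hπ0 (by positivity) (by positivity)
        (by linarith) h1 h2 (by linarith)
    · intro c h1 h2 h3
      simpa using hopt c h1 h2 h3
    · refine mul_left_cancel₀ hπ0.ne' ?_
      linear_combination hA + hB - hπe
  · intro p1 p2 cA cB h h0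
    obtain ⟨h1, h2, -⟩ := h.corner_eq heA1 heA2 h0
    exact ⟨h1, h2⟩
  · intro p1 p2 q1 q2 cA cB dA dB hc hc0 hd hd0
    obtain ⟨-, hc1, hc2, -, hc3⟩ := hc.corner_eq heA1 heA2 hc0
    obtain ⟨-, hd1, hd2, -, hd3⟩ := hd.corner_eq heA1 heA2 hd0
    have h2 : cA.2 = dA.2 := mul_left_cancel₀ hE.ne' (hc2.trans hd2.symm)
    exact ⟨Prod.ext (hc1.trans hd1.symm) h2, Prod.ext (hc0.trans hd0.symm) (by linarith)⟩
end

section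
/- Let e^A₁, e^A₂, e^B₁, e^B₂ > 0, D > 0, and suppose Δ ≥ 0, so that π^int is defined. Set X* = [(e^B₁+e^A₁)(e^B₂+e^A₂) + e^B₁e^B₂]/[(e^B₂+e^A₂)² − (e^B₂)²]. Then 0 < π^int ≤ X* < π^cor and (e^B₁+e^A₁)/(e^B₂+e^A₂) < X*. If moreover 4D < (e^B₁ + e^B₂·(e^B₁+e^A₁)/(e^B₂+e^A₂))², then π^int < (e^B₁+e^A₁)/(e^B₂+e^A₂). -/
/-- `Δ = [(e^B₁+e^A₁)(e^B₂+e^A₂) + e^B₁e^B₂]² − [(e^B₂+e^A₂)² − (e^B₂)²]·[(e^B₁+e^A₁)² + 4D − (e^B₁)²]`. -/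
noncomputable def Delta (DD eA1 eA2 eB1 eB2 : ℝ) : ℝ :=
  ((eB1+eA1)*(eB2+eA2) + eB1*eB2)^2
    - ((eB2+eA2)^2 - eB2^2) * ((eB1+eA1)^2 + 4*DD - eB1^2)

/-- `π^int = ((e^B₁+e^A₁)(e^B₂+e^A₂) + e^B₁e^B₂ − √Δ)/((e^B₂+e^A₂)² − (e^B₂)²)`. -/
noncomputable def piInt (DD eA1 eA2 eB1 eB2 : ℝ) : ℝ :=
  ((eB1+eA1)*(eB2+eA2) + eB1*eB2 - Real.sqrt (Delta DD eA1 eA2 eB1 eB2))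
    / ((eB2+eA2)^2 - eB2^2)

/-- `X* = [(e^B₁+e^A₁)(e^B₂+e^A₂) + e^B₁e^B₂]/[(e^B₂+e^A₂)² − (e^B₂)²]`, the critical
point of the quadratic `F`. -/
noncomputable def Xstar (eA1 eA2 eB1 eB2 : ℝ) : ℝ :=
  ((eB1+eA1)*(eB2+eA2) + eB1*eB2) / ((eB2+eA2)^2 - eB2^2)

/-- if `Δ ≥ 0` then `0 < π^int ≤ X* < π^cor` and
`(e^B₁+e^A₁)/(e^B₂+e^A₂) < X*`; if moreover `4D < (e^B₁ + e^B₂(e^B₁+e^A₁)/(e^B₂+e^A₂))²`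
then `π^int < (e^B₁+e^A₁)/(e^B₂+e^A₂)`. -/
theorem piInt_rank (DD eA1 eA2 eB1 eB2 : ℝ)
    (heA1 : 0 < eA1) (heA2 : 0 < eA2) (heB1 : 0 < eB1) (heB2 : 0 < eB2) (hD : 0 < DD)
    (hDelta : 0 ≤ Delta DD eA1 eA2 eB1 eB2) :
    0 < piInt DD eA1 eA2 eB1 eB2 ∧
    piInt DD eA1 eA2 eB1 eB2 ≤ Xstar eA1 eA2 eB1 eB2 ∧
    Xstar eA1 eA2 eB1 eB2 < (2*eB1 + eA1)/eA2 ∧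
    (eB1+eA1)/(eB2+eA2) < Xstar eA1 eA2 eB1 eB2 ∧
    (4*DD < (eB1 + eB2*((eB1+eA1)/(eB2+eA2)))^2 →
      piInt DD eA1 eA2 eB1 eB2 < (eB1+eA1)/(eB2+eA2)) := by
  have hc : 0 < (eB2+eA2)^2 - eB2^2 := by nlinarith [mul_pos heB2 heA2]
  have hQ : 0 < eB2 + eA2 := by positivity
  have hM : 0 < (eB1+eA1)*(eB2+eA2) + eB1*eB2 := by positivity
  refine ⟨?_, ?_, ?_, ?_, fun h4D => ?_⟩
  · refine div_pos (sub_pos.2 ((Real.sqrt_lt' hM).2 ?_)) hc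
    have hconst : 0 < (eB1+eA1)^2 + 4*DD - eB1^2 := by nlinarith [mul_pos heB1 heA1]
    exact sub_lt_self _ (mul_pos hc hconst)
  · exact div_le_div_of_nonneg_right (sub_le_self _ (Real.sqrt_nonneg _)) hc.le
  · rw [Xstar, div_lt_div_iff₀ hc heA2, ← sub_pos]
    have : (2*eB1 + eA1) * ((eB2+eA2)^2 - eB2^2) - ((eB1+eA1)*(eB2+eA2) + eB1*eB2) * eA2
        = eA2 * (eB1 * (eB2+eA2) + (eB1+eA1) * eB2) := by ring
    rw [this]
    positivity
  · rw [Xstar, div_lt_div_iff₀ hQ hc, ← sub_pos]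
    have : ((eB1+eA1)*(eB2+eA2) + eB1*eB2) * (eB2+eA2) - (eB1+eA1) * ((eB2+eA2)^2 - eB2^2)
        = eB1 * eB2 * (eB2+eA2) + (eB1+eA1) * eB2^2 := by ring
    rw [this]
    positivity
  · set r := (eB1+eA1)/(eB2+eA2) with hr
    have hP : eB1 + eA1 = r * (eB2+eA2) := by rw [hr, div_mul_cancel₀ _ hQ.ne']
    rw [piInt, div_lt_iff₀ hc, sub_lt_comm]
    refine Real.lt_sqrt_of_sq_lt ?_
    -- `Δ = (M - c r)² - c F(r)`, and `F(r) = 4D - (e^B₁ + e^B₂ r)²`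
    have : Delta DD eA1 eA2 eB1 eB2
        = ((eB1+eA1)*(eB2+eA2) + eB1*eB2 - r * ((eB2+eA2)^2 - eB2^2))^2
          + ((eB2+eA2)^2 - eB2^2) * ((eB1 + eB2*r)^2 - 4*DD) := by
      rw [Delta, hP]
      ring
    rw [this]
    exact lt_add_of_pos_right _ (mul_pos hc (sub_pos.2 h4D))
end

section
/- In the log–nonconvex economy, fix e^A₁, e^B₁, e^B₂ > 0 and D > 0 and let e^A₂ vary. (a) If x*·√D > e^B₁, then there exists M > 0 such that for every e^A₂ ≥ M there exists an equilibrium, any two equilibria have the same relative price p₂/p₁ and the same allocation, and this equilibrium satisfies c^B₁ = 0. (b) If x*·√D ≤ e^B₁, then there exists M > 0 such that for every e^A₂ ≥ M there exists an equilibrium, any two equilibria have the same relative price p₂/p₁ and the same allocation, and this equilibrium satisfies c^B₁ > 0. -/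
/-- Agent B's normalized utility as a function of the share `u` of income spent on good 1,
where `k` is the squared income (in units of good 1) divided by `D`. -/
noncomputable def shareUtility (k u : ℝ) : ℝ := k * u ^ 2 / 2 + Real.log (1 - u)

lemma shareUtility_zero (k : ℝ) : shareUtility k 0 = 0 := by simp [shareUtility]

lemma hasDerivAt_shareUtility {k b u : ℝ} (hk : k * (b * (1 - b)) = 1) (hu : u < 1) :
    HasDerivAt (shareUtility k) (k * ((u - (1 - b)) * (b - u)) / (1 - u)) u := by
  have h1 : (1 - u) ≠ 0 := by linarith
  have h := (((hasDerivAt_id u).pow 2).const_mul k).div_const 2 |>.add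
    (((hasDerivAt_id u).const_sub 1).log h1)
  refine h.congr_deriv ?_
  simp only [id]
  field_simp
  linear_combination 2 * hk

lemma continuousOn_shareUtility (k : ℝ) : ContinuousOn (shareUtility k) (Set.Iio 1) := by
  unfold shareUtility
  refine ContinuousOn.add (by fun_prop) (ContinuousOn.log (by fun_prop) fun u hu => ?_)
  have : u < 1 := hu
  linarith

lemma shareUtility_lt_or {k b u : ℝ} (hb : 1 / 2 ≤ b) (hb1 : b < 1)
    (hk : k * (b * (1 - b)) = 1) (hu0 : 0 < u) (hu1 : u < 1) (hub : u ≠ b) :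
    shareUtility k u < 0 ∨ shareUtility k u < shareUtility k b := by
  have hkpos : 0 < k := by
    by_contra! h
    have : 0 < b * (1 - b) := mul_pos (by linarith) (by linarith)
    nlinarith
  rcases le_or_gt u (1 - b) with h | h
  · left
    have := strictAntiOn_of_deriv_neg (convex_Icc 0 (1 - b))
      ((continuousOn_shareUtility k).mono fun x hx => by
        have := hx.2; simp only [Set.mem_Iio]; linarith)
      (fun x hx => by
        rw [interior_Icc] at hx
        obtain ⟨h1, h2⟩ := hx
        rw [(hasDerivAt_shareUtility hk (by linarith)).deriv]
        refine div_neg_of_neg_of_pos (mul_neg_of_pos_of_neg hkpos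
          (mul_neg_of_neg_of_pos ?_ ?_)) ?_ <;> linarith)
    have h' := this (Set.left_mem_Icc.2 (by linarith)) ⟨hu0.le, h⟩ hu0
    rwa [shareUtility_zero] at h'
  right
  rcases lt_or_gt_of_ne hub with h' | h'
  · have := strictMonoOn_of_deriv_pos (convex_Icc (1 - b) b)
      ((continuousOn_shareUtility k).mono fun x hx => by
        have := hx.2; simp only [Set.mem_Iio]; linarith)
      (fun x hx => by
        rw [interior_Icc] at hx
        obtain ⟨h1, h2⟩ := hx
        rw [(hasDerivAt_shareUtility hk (by linarith)).deriv]
        refine div_pos (mul_pos hkpos (mul_pos ?_ ?_)) ?_ <;> linarith)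
    exact this ⟨h.le, h'.le⟩ (Set.right_mem_Icc.2 (by linarith)) h'
  · have := strictAntiOn_of_deriv_neg (convex_Ico b 1)
      ((continuousOn_shareUtility k).mono fun x hx => hx.2)
      (fun x hx => by
        rw [interior_Ico] at hx
        obtain ⟨h1, h2⟩ := hx
        rw [(hasDerivAt_shareUtility hk h2).deriv]
        refine div_neg_of_neg_of_pos (mul_neg_of_pos_of_neg hkpos
          (mul_neg_of_pos_of_neg ?_ ?_)) ?_ <;> linarith)
    exact this (Set.left_mem_Ico.2 hb1) ⟨h'.le, hu1⟩ h'

lemma shareUtility_lt_of_lt {k l u : ℝ} (h : k < l) (hu : 0 < u) :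
    shareUtility k u < shareUtility l u := by
  have := mul_lt_mul_of_pos_right h (pow_pos hu 2)
  unfold shareUtility
  linarith

lemma shareUtility_neg_of_lt {k l b u : ℝ} (hb : 1 / 2 ≤ b) (hb1 : b < 1)
    (hl : l * (b * (1 - b)) = 1) (h0 : shareUtility l b = 0) (hkl : k < l)
    (hu0 : 0 < u) (hu1 : u < 1) : shareUtility k u < 0 := by
  refine (shareUtility_lt_of_lt hkl hu0).trans_le ?_
  rcases eq_or_ne u b with rfl | hub
  · exact h0.le
  · rcases shareUtility_lt_or hb hb1 hl hu0 hu1 hub with h | h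
    · exact h.le
    · exact (h.trans_eq h0).le

lemma shareUtility_lt_of_gt {k l a b u : ℝ} (ha : 0 < a) (ha1 : a < 1)
    (h0 : shareUtility l a = 0) (hlk : l < k) (hb : 1 / 2 ≤ b) (hb1 : b < 1)
    (hk : k * (b * (1 - b)) = 1) (hu0 : 0 ≤ u) (hu1 : u < 1) (hub : u ≠ b) :
    shareUtility k u < shareUtility k b := by
  have hpos : 0 < shareUtility k a := h0 ▸ shareUtility_lt_of_lt hlk ha
  have hbpos : 0 < shareUtility k b := by
    rcases eq_or_ne a b with rfl | hab
    · exact hpos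
    · rcases shareUtility_lt_or hb hb1 hk ha ha1 hab with h | h <;> linarith
  rcases hu0.eq_or_lt with rfl | hu0
  · rwa [shareUtility_zero]
  · rcases shareUtility_lt_or hb hb1 hk hu0 hu1 hub with h | h <;> linarith

/-- The larger root `b` of `y² b (1 - b) = 1`. -/
noncomputable def interiorShare (y : ℝ) : ℝ := (1 + Real.sqrt (1 - 4 / y ^ 2)) / 2

lemma interiorShare_spec {y : ℝ} (hy : 2 < y) :
    1 / 2 ≤ interiorShare y ∧ interiorShare y < 1 ∧
      y ^ 2 * (interiorShare y * (1 - interiorShare y)) = 1 := by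
  have hpos : 0 < 4 / y ^ 2 := by positivity
  have hle : 4 / y ^ 2 ≤ 1 := by rw [div_le_one (by positivity)]; nlinarith
  have hsq := Real.sq_sqrt (sub_nonneg.2 hle)
  have hnn := Real.sqrt_nonneg (1 - 4 / y ^ 2)
  unfold interiorShare
  refine ⟨by linarith, by nlinarith, ?_⟩
  have : y ^ 2 * (4 / y ^ 2) = 4 := by field_simp
  linear_combination (-(y ^ 2) / 4) * hsq + this / 4

lemma mul_interiorShare {y : ℝ} (hy : 2 < y) :
    y * interiorShare y = (y + Real.sqrt (y ^ 2 - 4)) / 2 := by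
  have h : y ^ 2 - 4 = y ^ 2 * (1 - 4 / y ^ 2) := by field_simp
  rw [h, Real.sqrt_mul (by positivity), Real.sqrt_sq (by linarith), interiorShare]
  ring

lemma shareUtility_interiorShare {y : ℝ} (hy : 2 < y) :
    shareUtility (y ^ 2) (interiorShare y) = g y := by
  have hlt := (interiorShare_spec hy).2.1
  have h : y ^ 2 * interiorShare y ^ 2 / 2 = 1 / 8 * (y + Real.sqrt (y ^ 2 - 4)) ^ 2 := by
    rw [← mul_pow, mul_interiorShare hy]; ring
  have h' : 1 - interiorShare y = (1 - Real.sqrt (1 - 4 / y ^ 2)) / 2 := by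
    rw [interiorShare]; ring
  have hne : 1 - Real.sqrt (1 - 4 / y ^ 2) ≠ 0 := by
    intro h0; rw [h0] at h'; linarith
  rw [shareUtility, h, h', Real.log_div hne two_ne_zero, g]
  ring

lemma log_add_log_le {m x y : ℝ} (hm : 0 < m) (hx : 0 < x) (hy : 0 < y) (h : x + y ≤ m) :
    Real.log x + Real.log y ≤ Real.log (m / 2) + Real.log (m / 2) ∧
      (Real.log (m / 2) + Real.log (m / 2) ≤ Real.log x + Real.log y →
        x = m / 2 ∧ y = m / 2) := by
  have hm2 : 0 < m / 2 := by positivity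
  have hsum : x / (m / 2) + y / (m / 2) ≤ 2 := by
    rw [← add_div, div_le_iff₀ hm2]; linarith
  have hx' := Real.log_le_sub_one_of_pos (div_pos hx hm2)
  have hy' := Real.log_le_sub_one_of_pos (div_pos hy hm2)
  have ex := Real.log_div hx.ne' hm2.ne'
  have ey := Real.log_div hy.ne' hm2.ne'
  refine ⟨by linarith, fun hle => ⟨?_, ?_⟩⟩
  · by_contra hne
    have := Real.log_lt_sub_one_of_pos (div_pos hx hm2) (by rwa [ne_eq, div_eq_one_iff_eq hm2.ne'])
    linarith
  · by_contra hne
    have := Real.log_lt_sub_one_of_pos (div_pos hy hm2) (by rwa [ne_eq, div_eq_one_iff_eq hm2.ne'])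
    linarith

/-- Agent A spends half of the income `m` on each good. -/
lemma demandA_iff {p1 p2 m : ℝ} {cA : ℝ × ℝ} (hp1 : 0 < p1) (hp2 : 0 < p2) (hm : 0 < m) :
    ((0 < cA.1 ∧ 0 < cA.2 ∧ p1 * cA.1 + p2 * cA.2 ≤ m) ∧
      ∀ c : ℝ × ℝ, 0 < c.1 → 0 < c.2 → p1 * c.1 + p2 * c.2 ≤ m →
        Real.log c.1 + Real.log c.2 ≤ Real.log cA.1 + Real.log cA.2) ↔
    cA = (m / 2 / p1, m / 2 / p2) := by
  have hlog : ∀ p x : ℝ, 0 < p → 0 < x → Real.log (p * x) = Real.log p + Real.log x :=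
    fun p x hp hx => Real.log_mul hp.ne' hx.ne'
  have e1 : p1 * (m / 2 / p1) = m / 2 := by field_simp
  have e2 : p2 * (m / 2 / p2) = m / 2 := by field_simp
  have d1 : 0 < m / 2 / p1 := by positivity
  have d2 : 0 < m / 2 / p2 := by positivity
  have l1 := hlog p1 _ hp1 d1
  have l2 := hlog p2 _ hp2 d2
  rw [e1] at l1
  rw [e2] at l2
  constructor
  · rintro ⟨⟨h1, h2, hb⟩, hmax⟩
    have := hmax (m / 2 / p1, m / 2 / p2) d1 d2 (by simp only [e1, e2]; linarith)
    simp only at this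
    obtain ⟨hx, hy⟩ := (log_add_log_le hm (mul_pos hp1 h1) (mul_pos hp2 h2) hb).2
      (by rw [hlog p1 _ hp1 h1, hlog p2 _ hp2 h2]; linarith)
    ext
    · simp only; rw [eq_div_iff hp1.ne']; linarith
    · simp only; rw [eq_div_iff hp2.ne']; linarith
  · rintro rfl
    refine ⟨⟨d1, d2, by simp only [e1, e2]; linarith⟩, fun c h1 h2 hb => ?_⟩
    have := (log_add_log_le hm (mul_pos hp1 h1) (mul_pos hp2 h2) hb).1
    rw [hlog p1 _ hp1 h1, hlog p2 _ hp2 h2] at this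
    simp only
    linarith

lemma utilityB_eq {D p1 p2 m x y : ℝ} (hD : 0 < D) (hp1 : 0 < p1) (hp2 : 0 < p2) (hm : 0 < m)
    (hy : 0 < y) :
    x ^ 2 / 2 + D * Real.log y =
      D * ((m / p1) ^ 2 / D * (p1 * x / m) ^ 2 / 2 + Real.log (p2 * y / m)
        + Real.log (m / p2)) := by
  have h : Real.log (p2 * y / m) + Real.log (m / p2) = Real.log y := by
    rw [← Real.log_mul (by positivity) (by positivity)]
    congr 1
    field_simp
  rw [add_assoc, h]
  field_simp

/-- If the normalized utility has a unique maximizer `u₀`, agent B spends the share `u₀` of the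
income `m` on good 1. -/
lemma demandB_iff {D p1 p2 m u₀ : ℝ} {cB : ℝ × ℝ} (hD : 0 < D) (hp1 : 0 < p1) (hp2 : 0 < p2)
    (hm : 0 < m) (hu₀ : 0 ≤ u₀) (hu₁ : u₀ < 1)
    (hmax : ∀ u, 0 ≤ u → u < 1 → u ≠ u₀ →
      shareUtility ((m / p1) ^ 2 / D) u < shareUtility ((m / p1) ^ 2 / D) u₀) :
    ((0 ≤ cB.1 ∧ 0 < cB.2 ∧ p1 * cB.1 + p2 * cB.2 ≤ m) ∧
      ∀ c : ℝ × ℝ, 0 ≤ c.1 → 0 < c.2 → p1 * c.1 + p2 * c.2 ≤ m →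
        c.1 ^ 2 / 2 + D * Real.log c.2 ≤ cB.1 ^ 2 / 2 + D * Real.log cB.2) ↔
    cB = (u₀ * m / p1, (1 - u₀) * m / p2) := by
  have hle : ∀ u, 0 ≤ u → u < 1 →
      shareUtility ((m / p1) ^ 2 / D) u ≤ shareUtility ((m / p1) ^ 2 / D) u₀ := by
    intro u h0 h1
    rcases eq_or_ne u u₀ with rfl | h
    · exact le_rfl
    · exact (hmax u h0 h1 h).le
  have d1 : 0 ≤ u₀ * m / p1 := by positivity
  have d2 : 0 < (1 - u₀) * m / p2 := div_pos (mul_pos (by linarith) hm) hp2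
  have e1 : p1 * (u₀ * m / p1) = u₀ * m := by field_simp
  have e2 : p2 * ((1 - u₀) * m / p2) = (1 - u₀) * m := by field_simp
  have hval := utilityB_eq (x := u₀ * m / p1) hD hp1 hp2 hm d2
  rw [e1, e2, mul_div_cancel_right₀ _ hm.ne', mul_div_cancel_right₀ _ hm.ne'] at hval
  change _ = D * (shareUtility _ u₀ + _) at hval
  have hfeas : ∀ x y : ℝ, 0 ≤ x → 0 < y → p1 * x + p2 * y ≤ m →
      0 ≤ p1 * x / m ∧ p1 * x / m < 1 ∧ 0 < p2 * y / m ∧ p2 * y / m ≤ 1 - p1 * x / m := by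
    intro x y hx hy hb
    have : p1 * x / m + p2 * y / m ≤ 1 := by rw [← add_div, div_le_one hm]; exact hb
    have hy' : 0 < p2 * y / m := by positivity
    exact ⟨by positivity, by linarith, hy', by linarith⟩
  constructor
  · rintro ⟨⟨h1, h2, hb⟩, hopt⟩
    have hcmp := hopt (u₀ * m / p1, (1 - u₀) * m / p2) d1 d2
      (by simp only [e1, e2]; linarith)
    simp only at hcmp
    rw [hval, utilityB_eq (x := cB.1) hD hp1 hp2 hm h2] at hcmp
    have hcmp := le_of_mul_le_mul_left hcmp hD
    obtain ⟨f1, f2, f3, f4⟩ := hfeas _ _ h1 h2 hb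
    have hlog := Real.log_le_log f3 f4
    have hu : p1 * cB.1 / m = u₀ := by
      by_contra hne
      have := hmax _ f1 f2 hne
      rw [shareUtility] at this
      linarith
    have hv : p2 * cB.2 / m = 1 - u₀ := by
      by_contra hne
      rw [hu] at f4 hcmp
      have := Real.log_lt_log f3 (lt_of_le_of_ne f4 hne)
      rw [shareUtility] at hcmp
      linarith
    rw [div_eq_iff hm.ne'] at hu hv
    ext
    · simp only; rw [eq_div_iff hp1.ne']; linarith
    · simp only; rw [eq_div_iff hp2.ne']; linarith
  · rintro rfl
    refine ⟨⟨d1, d2, by simp only [e1, e2]; linarith⟩, fun c h1 h2 hb => ?_⟩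
    simp only
    rw [hval, utilityB_eq (x := c.1) hD hp1 hp2 hm h2]
    obtain ⟨f1, f2, f3, f4⟩ := hfeas _ _ h1 h2 hb
    have hlog := Real.log_le_log f3 f4
    have := hle _ f1 f2
    refine mul_le_mul_of_nonneg_left ?_ hD.le
    rw [shareUtility] at this
    linarith

/-- Equilibria at prices where agent B has a unique optimal expenditure share `u₀` on good 1. -/
lemma logEquil_iff {D eA1 eA2 eB1 eB2 p1 p2 u₀ : ℝ} {cA cB : ℝ × ℝ} (hD : 0 < D)
    (heA1 : 0 < eA1) (heA2 : 0 < eA2) (heB1 : 0 < eB1) (heB2 : 0 < eB2)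
    (hp1 : 0 < p1) (hp2 : 0 < p2) (hu₀ : 0 ≤ u₀) (hu₁ : u₀ < 1)
    (hmax : ∀ u, 0 ≤ u → u < 1 → u ≠ u₀ →
      shareUtility ((eB1 + p2 / p1 * eB2) ^ 2 / D) u <
        shareUtility ((eB1 + p2 / p1 * eB2) ^ 2 / D) u₀) :
    LogEquil D eA1 eA2 eB1 eB2 p1 p2 cA cB ↔
      cA = ((eA1 + p2 / p1 * eA2) / 2, (eA1 + p2 / p1 * eA2) / 2 / (p2 / p1)) ∧
      cB = (u₀ * (eB1 + p2 / p1 * eB2), (1 - u₀) * (eB1 + p2 / p1 * eB2) / (p2 / p1)) ∧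
      (eA1 + p2 / p1 * eA2) / 2 + u₀ * (eB1 + p2 / p1 * eB2) = eA1 + eB1 := by
  have hmA : 0 < p1 * eA1 + p2 * eA2 := by positivity
  have hmB : 0 < p1 * eB1 + p2 * eB2 := by positivity
  have hw : (p1 * eB1 + p2 * eB2) / p1 = eB1 + p2 / p1 * eB2 := by field_simp
  rw [← hw] at hmax
  have hA := demandA_iff (cA := cA) hp1 hp2 hmA
  have hB := demandB_iff (cB := cB) hD hp1 hp2 hmB hu₀ hu₁ hmax
  have a1 : (p1 * eA1 + p2 * eA2) / 2 / p1 = (eA1 + p2 / p1 * eA2) / 2 := by field_simp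
  have a2 : (p1 * eA1 + p2 * eA2) / 2 / p2 = (eA1 + p2 / p1 * eA2) / 2 / (p2 / p1) := by
    field_simp
  have b1 : u₀ * (p1 * eB1 + p2 * eB2) / p1 = u₀ * (eB1 + p2 / p1 * eB2) := by field_simp
  have b2 : (1 - u₀) * (p1 * eB1 + p2 * eB2) / p2 =
      (1 - u₀) * (eB1 + p2 / p1 * eB2) / (p2 / p1) := by field_simp
  rw [a1, a2] at hA
  rw [b1, b2] at hB
  constructor
  · rintro ⟨-, -, hA1, hA2, hB1, hB2, hc1, -⟩
    have eA := hA.1 ⟨hA1, hA2⟩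
    have eB := hB.1 ⟨hB1, hB2⟩
    refine ⟨eA, eB, ?_⟩
    rw [eA, eB] at hc1
    exact hc1
  · rintro ⟨eA, eB, hc⟩
    obtain ⟨hA1, hA2⟩ := hA.2 eA
    obtain ⟨hB1, hB2⟩ := hB.2 eB
    refine ⟨hp1, hp2, hA1, hA2, hB1, hB2, ?_, ?_⟩
    · rw [eA, eB]; exact hc
    · rw [eA, eB]
      have hq : 0 < p2 / p1 := by positivity
      simp only
      rw [← add_div, div_eq_iff hq.ne']
      linear_combination -hc

lemma LogEquil.relPrice_mul_le {D eA1 eA2 eB1 eB2 p1 p2 : ℝ} {cA cB : ℝ × ℝ}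
    (h : LogEquil D eA1 eA2 eB1 eB2 p1 p2 cA cB) (heA1 : 0 < eA1) (heA2 : 0 < eA2) :
    p2 / p1 * eA2 ≤ eA1 + 2 * eB1 := by
  obtain ⟨hp1, hp2, hA1, hA2, ⟨hB, -⟩, -, hc, -⟩ := h
  have hA := (demandA_iff hp1 hp2 (by positivity)).1 ⟨hA1, hA2⟩
  have a1 : (p1 * eA1 + p2 * eA2) / 2 / p1 = (eA1 + p2 / p1 * eA2) / 2 := by field_simp
  rw [hA] at hc
  simp only [a1] at hc
  linarith

/-- The demand `(w + √(w² - 4D)) / 2` of agent B for good 1 at an interior optimum. -/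
lemma interiorShare_mul_income {D w : ℝ} (hD : 0 < D) (hw : 2 < w / Real.sqrt D) :
    interiorShare (w / Real.sqrt D) * w = (w + Real.sqrt (w ^ 2 - 4 * D)) / 2 := by
  have hs : 0 < Real.sqrt D := Real.sqrt_pos.2 hD
  have h := mul_interiorShare hw
  have h2 : w ^ 2 - 4 * D = D * ((w / Real.sqrt D) ^ 2 - 4) := by
    rw [div_pow, Real.sq_sqrt hD.le]; field_simp
  rw [h2, Real.sqrt_mul hD.le]
  have h3 : w = Real.sqrt D * (w / Real.sqrt D) := by field_simp
  generalize w / Real.sqrt D = y at *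
  subst h3
  linear_combination Real.sqrt D * h

lemma monotoneOn_interiorDemand (D : ℝ) :
    MonotoneOn (fun w : ℝ => (w + Real.sqrt (w ^ 2 - 4 * D)) / 2) (Set.Ici 0) := by
  intro a ha b _ hab
  have : Real.sqrt (a ^ 2 - 4 * D) ≤ Real.sqrt (b ^ 2 - 4 * D) :=
    Real.sqrt_le_sqrt (by have := pow_le_pow_left₀ ha hab 2; linarith)
  simp only
  linarith

/-- fixing `e^A₁, e^B₁, e^B₂, D`, for all large enough `e^A₂` an equilibrium
exists, is unique (same relative price and allocation), and is corner (`c^B₁ = 0`) when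
`x* √D > e^B₁`, resp. interior (`c^B₁ > 0`) when `x* √D ≤ e^B₁`. -/
theorem equilibrium_large_eA2 (DD eA1 eB1 eB2 xs : ℝ)
    (heA1 : 0 < eA1) (heB1 : 0 < eB1) (heB2 : 0 < eB2) (hD : 0 < DD)
    (hxs2 : 2 < xs) (hxs0 : g xs = 0) :
    (eB1 < xs * Real.sqrt DD →
      ∃ M : ℝ, 0 < M ∧ ∀ eA2 : ℝ, M ≤ eA2 →
        (∃ p1 p2 : ℝ, ∃ cA cB : ℝ × ℝ, LogEquil DD eA1 eA2 eB1 eB2 p1 p2 cA cB) ∧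
        (∀ p1 p2 q1 q2 : ℝ, ∀ cA cB dA dB : ℝ × ℝ,
          LogEquil DD eA1 eA2 eB1 eB2 p1 p2 cA cB →
          LogEquil DD eA1 eA2 eB1 eB2 q1 q2 dA dB →
          p2/p1 = q2/q1 ∧ cA = dA ∧ cB = dB) ∧
        (∀ p1 p2 : ℝ, ∀ cA cB : ℝ × ℝ,
          LogEquil DD eA1 eA2 eB1 eB2 p1 p2 cA cB → cB.1 = 0)) ∧
    (xs * Real.sqrt DD ≤ eB1 →
      ∃ M : ℝ, 0 < M ∧ ∀ eA2 : ℝ, M ≤ eA2 →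
        (∃ p1 p2 : ℝ, ∃ cA cB : ℝ × ℝ, LogEquil DD eA1 eA2 eB1 eB2 p1 p2 cA cB) ∧
        (∀ p1 p2 q1 q2 : ℝ, ∀ cA cB dA dB : ℝ × ℝ,
          LogEquil DD eA1 eA2 eB1 eB2 p1 p2 cA cB →
          LogEquil DD eA1 eA2 eB1 eB2 q1 q2 dA dB →
          p2/p1 = q2/q1 ∧ cA = dA ∧ cB = dB) ∧
        (∀ p1 p2 : ℝ, ∀ cA cB : ℝ × ℝ,
          LogEquil DD eA1 eA2 eB1 eB2 p1 p2 cA cB → 0 < cB.1)) := by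
  have hs : 0 < Real.sqrt DD := Real.sqrt_pos.2 hD
  obtain ⟨hb, hb1, hbk⟩ := interiorShare_spec hxs2
  have h0 : shareUtility (xs ^ 2) (interiorShare xs) = 0 := by
    rw [shareUtility_interiorShare hxs2, hxs0]
  have hdiv : ∀ w, w ^ 2 / DD = (w / Real.sqrt DD) ^ 2 := fun w => by
    rw [div_pow, Real.sq_sqrt hD.le]
  constructor
  · intro hlt
    have hgap : 0 < xs * Real.sqrt DD - eB1 := by linarith
    refine ⟨(eA1 + 2 * eB1) * eB2 / (xs * Real.sqrt DD - eB1) + 1, by positivity, ?_⟩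
    intro eA2 hM
    have heA2 : 0 < eA2 := lt_of_lt_of_le (by positivity) hM
    have hbound : (eA1 + 2 * eB1) * eB2 < eA2 * (xs * Real.sqrt DD - eB1) := by
      rw [← div_lt_iff₀ hgap]; linarith
    have hcorner : ∀ q, 0 < q → q * eA2 ≤ eA1 + 2 * eB1 → ∀ u, 0 ≤ u → u < 1 → u ≠ 0 →
        shareUtility ((eB1 + q * eB2) ^ 2 / DD) u <
          shareUtility ((eB1 + q * eB2) ^ 2 / DD) 0 := by
      intro q hq hqle u hu0 hu1 hu
      rw [shareUtility_zero, hdiv]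
      refine shareUtility_neg_of_lt hb hb1 hbk h0 ?_ (lt_of_le_of_ne hu0 hu.symm) hu1
      refine pow_lt_pow_left₀ ?_ (by positivity) two_ne_zero
      rw [div_lt_iff₀ hs]
      have h1 := mul_le_mul_of_nonneg_right hqle heB2.le
      have h2 : eA2 * (q * eB2) < eA2 * (xs * Real.sqrt DD - eB1) := by linarith
      have h3 := lt_of_mul_lt_mul_left h2 heA2.le
      linarith
    have hchar : ∀ p1 p2 : ℝ, ∀ cA cB : ℝ × ℝ, LogEquil DD eA1 eA2 eB1 eB2 p1 p2 cA cB → _ :=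
      fun p1 p2 cA cB h => (logEquil_iff hD heA1 heA2 heB1 heB2 h.1 h.2.1 le_rfl zero_lt_one
        (hcorner _ (div_pos h.2.1 h.1) (h.relPrice_mul_le heA1 heA2))).1 h
    refine ⟨?_, ?_, ?_⟩
    · have hq : 0 < (eA1 + 2 * eB1) / eA2 := by positivity
      have hqe : (eA1 + 2 * eB1) / eA2 * eA2 = eA1 + 2 * eB1 := by field_simp
      refine ⟨1, (eA1 + 2 * eB1) / eA2, _, _,
        (logEquil_iff hD heA1 heA2 heB1 heB2 one_pos hq le_rfl zero_lt_one
          (by rw [div_one]; exact hcorner _ hq hqe.le)).2 ⟨rfl, rfl, ?_⟩⟩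
      rw [div_one, hqe]
      ring
    · intro p1 p2 q1 q2 cA cB dA dB hp hq
      obtain ⟨hcA, hcB, hc⟩ := hchar _ _ _ _ hp
      obtain ⟨hdA, hdB, hd⟩ := hchar _ _ _ _ hq
      have hpq : p2 / p1 = q2 / q1 := mul_right_cancel₀ heA2.ne' (by linarith)
      rw [← hpq] at hdA hdB
      exact ⟨hpq, hcA.trans hdA.symm, hcB.trans hdB.symm⟩
    · intro p1 p2 cA cB h
      rw [(hchar _ _ _ _ h).2.1]
      simp
  · intro hle
    refine ⟨1, one_pos, fun eA2 hM => ?_⟩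
    have heA2 : 0 < eA2 := by linarith
    have hy : ∀ q, 0 < q → xs < (eB1 + q * eB2) / Real.sqrt DD := by
      intro q hq
      rw [lt_div_iff₀ hs]
      have := mul_pos hq heB2
      linarith
    have hspec : ∀ q : ℝ, 0 < q → _ := fun q hq => interiorShare_spec (hxs2.trans (hy q hq))
    have hinterior : ∀ q, 0 < q → ∀ u, 0 ≤ u → u < 1 →
        u ≠ interiorShare ((eB1 + q * eB2) / Real.sqrt DD) →
        shareUtility ((eB1 + q * eB2) ^ 2 / DD) u < shareUtility ((eB1 + q * eB2) ^ 2 / DD)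
          (interiorShare ((eB1 + q * eB2) / Real.sqrt DD)) := by
      intro q hq u hu0 hu1 hu
      obtain ⟨s1, s2, s3⟩ := hspec q hq
      rw [hdiv]
      exact shareUtility_lt_of_gt (by linarith) hb1 h0
        (pow_lt_pow_left₀ (hy q hq) (by linarith) two_ne_zero) s1 s2 s3 hu0 hu1 hu
    have hiff : ∀ p1 p2 : ℝ, ∀ cA cB : ℝ × ℝ, 0 < p1 → 0 < p2 →
        (LogEquil DD eA1 eA2 eB1 eB2 p1 p2 cA cB ↔ _) := fun p1 p2 cA cB hp1 hp2 =>
      logEquil_iff hD heA1 heA2 heB1 heB2 hp1 hp2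
        (by have := (hspec _ (div_pos hp2 hp1)).1; linarith)
        (hspec _ (div_pos hp2 hp1)).2.1 (hinterior _ (div_pos hp2 hp1))
    have hdemand : ∀ q : ℝ, 0 < q → _ := fun q hq =>
      interiorShare_mul_income hD (hxs2.trans (hy q hq))
    refine ⟨?_, ?_, ?_⟩
    · let Z : ℝ → ℝ := fun q => (eA1 + q * eA2) / 2 +
        (eB1 + q * eB2 + Real.sqrt ((eB1 + q * eB2) ^ 2 - 4 * DD)) / 2
      have hZc : Continuous Z := by fun_prop
      have hZ0 : Z 0 < eA1 + eB1 := by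
        have : Real.sqrt (eB1 ^ 2 - 4 * DD) ≤ eB1 := Real.sqrt_le_iff.2 ⟨heB1.le, by linarith⟩
        simp only [Z, zero_mul, add_zero]
        linarith
      have hZ1 : eA1 + eB1 ≤ Z (2 * (eA1 + eB1) / eA2) := by
        have h1 : 2 * (eA1 + eB1) / eA2 * eA2 = 2 * (eA1 + eB1) := by field_simp
        have h2 : 0 < 2 * (eA1 + eB1) / eA2 * eB2 := by positivity
        have h3 := Real.sqrt_nonneg ((eB1 + 2 * (eA1 + eB1) / eA2 * eB2) ^ 2 - 4 * DD)
        simp only [Z]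
        linarith
      obtain ⟨q, ⟨hq0, -⟩, hq⟩ := intermediate_value_Icc
        (by positivity : (0 : ℝ) ≤ 2 * (eA1 + eB1) / eA2) hZc.continuousOn ⟨hZ0.le, hZ1⟩
      have hqpos : 0 < q := by
        rcases hq0.eq_or_lt with rfl | h
        · exact absurd hq hZ0.ne
        · exact h
      refine ⟨1, q, _, _, (hiff _ _ _ _ one_pos hqpos).2 ⟨rfl, rfl, ?_⟩⟩
      rw [div_one, hdemand q hqpos]
      exact hq
    · intro p1 p2 q1 q2 cA cB dA dB hp hq
      obtain ⟨hcA, hcB, hc⟩ := (hiff _ _ _ _ hp.1 hp.2.1).1 hp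
      obtain ⟨hdA, hdB, hd⟩ := (hiff _ _ _ _ hq.1 hq.2.1).1 hq
      have hp0 := div_pos hp.2.1 hp.1
      have hq0 := div_pos hq.2.1 hq.1
      rw [hdemand _ hp0] at hc
      rw [hdemand _ hq0] at hd
      have hmono : ∀ r s, 0 < r → r < s → (eA1 + r * eA2) / 2 +
          (eB1 + r * eB2 + Real.sqrt ((eB1 + r * eB2) ^ 2 - 4 * DD)) / 2 <
          (eA1 + s * eA2) / 2 +
          (eB1 + s * eB2 + Real.sqrt ((eB1 + s * eB2) ^ 2 - 4 * DD)) / 2 := by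
        intro r s hr hrs
        have hs0 := hr.trans hrs
        have h1 := mul_lt_mul_of_pos_right hrs heA2
        have h2 := mul_lt_mul_of_pos_right hrs heB2
        have h3 := monotoneOn_interiorDemand DD
          (Set.mem_Ici.2 (by positivity : 0 ≤ eB1 + r * eB2))
          (Set.mem_Ici.2 (by positivity : 0 ≤ eB1 + s * eB2)) (by linarith)
        simp only at h3
        linarith
      have hpq : p2 / p1 = q2 / q1 := by
        rcases lt_trichotomy (p2 / p1) (q2 / q1) with h | h | h
        · have := hmono _ _ hp0 h; linarith
        · exact h
        · have := hmono _ _ hq0 h; linarith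
      rw [← hpq] at hdA hdB
      exact ⟨hpq, hcA.trans hdA.symm, hcB.trans hdB.symm⟩
    · intro p1 p2 cA cB h
      rw [((hiff _ _ _ _ h.1 h.2.1).1 h).2.1]
      have hq := div_pos h.2.1 h.1
      have := (hspec _ hq).1
      exact mul_pos (by linarith) (by positivity)
end

section
/- In the log–nonconvex economy, fix e^A₂, e^B₁, e^B₂ > 0 and D > 0 and let e^A₁ vary. Then there exists M > 0 such that for every e^A₁ ≥ M there exists an equilibrium, any two equilibria have the same relative price p₂/p₁ and the same allocation, and this equilibrium satisfies c^B₁ > 0. -/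
/-- A second-order upper bound for the logarithm, strict away from `1`. -/
theorem log_lt_sub_one_sub_sq_div {k y : ℝ} (hk : 8 ≤ k) (hy : 0 < y) (hyk : y ≤ 1 + k)
    (hne : y ≠ 1) : Real.log y < (y - 1) - (y - 1) ^ 2 / (2 * k) := by
  obtain ⟨r, hr, rfl⟩ : ∃ r : ℝ, 0 < r ∧ r ^ 2 = y :=
    ⟨√y, Real.sqrt_pos.2 hy, Real.sq_sqrt hy.le⟩
  have hr1 : r ≠ 1 := by rintro rfl; norm_num at hne
  have hlog := Real.log_lt_sub_one_of_pos hr hr1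
  have hrk : r ≤ (k - 2) / 2 := abs_le_of_sq_le_sq' (by nlinarith) (by linarith) |>.2
  have hsq : (r + 1) ^ 2 ≤ 2 * k := by nlinarith
  have hquad : (r ^ 2 - 1) ^ 2 / (2 * k) ≤ (r - 1) ^ 2 := by
    rw [div_le_iff₀ (by linarith)]
    nlinarith [mul_le_mul_of_nonneg_left hsq (sq_nonneg (r - 1))]
  rw [Real.log_pow]
  push_cast
  nlinarith

/-- When `s` is a small root of `s (w - s) = D`, spending `s` on the second good is the strict
optimum of agent B with wealth `w`. -/
theorem agentB_utility_lt {D s w x : ℝ} (hs : 0 < s) (hsD : 8 * s ^ 2 ≤ D)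
    (hw : w * s = s ^ 2 + D) (hx : 0 < x) (hxw : x ≤ w) (hne : x ≠ s) :
    (w - x) ^ 2 / 2 + D * Real.log x < (w - s) ^ 2 / 2 + D * Real.log s := by
  have hs2 : 0 < s ^ 2 := by positivity
  have hD : 0 < D := by linarith
  have hlog := log_lt_sub_one_sub_sq_div (k := D / s ^ 2) (y := x / s)
    (by rwa [le_div_iff₀ hs2]) (by positivity)
    (by
      rw [div_le_iff₀ hs]
      have : (1 + D / s ^ 2) * s = w := by
        field_simp
        linarith
      linarith)
    (by rwa [Ne, div_eq_one_iff_eq hs.ne'])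
  rw [Real.log_div hx.ne' hs.ne'] at hlog
  have hmul := mul_lt_mul_of_pos_left hlog hD
  have hbound : D * (x / s - 1 - (x / s - 1) ^ 2 / (2 * (D / s ^ 2)))
      = (w - s) * (x - s) - (x - s) ^ 2 / 2 := by
    obtain rfl : D = w * s - s ^ 2 := by linarith
    have : w - s ≠ 0 := by
      rintro h
      nlinarith
    field_simp
  rw [hbound] at hmul
  nlinarith

/-- A positive quadratic at `0` that is nonpositive at `t > 0` has a root in `(0, t]`. -/
theorem exists_quadratic_root {a b c t : ℝ} (hc : 0 < c) (ht : 0 < t)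
    (h : a * t ^ 2 - b * t + c ≤ 0) : ∃ s, 0 < s ∧ s ≤ t ∧ a * s ^ 2 - b * s + c = 0 := by
  have hcont : ContinuousOn (fun s : ℝ => a * s ^ 2 - b * s + c) (Set.Icc 0 t) := by fun_prop
  obtain ⟨s, ⟨hs0, hst⟩, hs⟩ := intermediate_value_Icc' ht.le hcont
    (show (0 : ℝ) ∈ _ from ⟨h, by simpa using hc.le⟩)
  refine ⟨s, lt_of_le_of_ne hs0 ?_, hst, hs⟩
  rintro rfl
  simp at hs
  exact hc.ne' hs

/-- Only the relative price matters. -/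
theorem LogEquil.normalize {D eA1 eA2 eB1 eB2 p1 p2 : ℝ} {cA cB : ℝ × ℝ}
    (h : LogEquil D eA1 eA2 eB1 eB2 p1 p2 cA cB) :
    LogEquil D eA1 eA2 eB1 eB2 1 (p2 / p1) cA cB := by
  obtain ⟨hp1, hp2, ⟨hA1, hA2, hA⟩, hAopt, ⟨hB1, hB2, hB⟩, hBopt, hclear⟩ := h
  have hbudget : ∀ a b c d : ℝ,
      1 * a + p2 / p1 * b ≤ 1 * c + p2 / p1 * d ↔ p1 * a + p2 * b ≤ p1 * c + p2 * d := by
    intro a b c d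
    have hscale : ∀ u v : ℝ, p1 * u + p2 * v = p1 * (1 * u + p2 / p1 * v) := by
      intro u v
      field_simp
    rw [hscale, hscale, mul_le_mul_iff_right₀ hp1]
  exact ⟨one_pos, div_pos hp2 hp1, ⟨hA1, hA2, (hbudget _ _ _ _).2 hA⟩,
    fun c h1 h2 h => hAopt c h1 h2 ((hbudget _ _ _ _).1 h),
    ⟨hB1, hB2, (hbudget _ _ _ _).2 hB⟩,
    fun c h1 h2 h => hBopt c h1 h2 ((hbudget _ _ _ _).1 h), hclear⟩

/-- Spending half of the wealth `m` on each good is optimal for the logarithmic consumer. -/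
theorem agentA_utility_le {p m c₁ c₂ : ℝ} (hp : 0 < p) (hm : 0 < m) (h₁ : 0 < c₁) (h₂ : 0 < c₂)
    (h : c₁ + p * c₂ ≤ m) :
    Real.log c₁ + Real.log c₂ ≤ Real.log (m / 2) + Real.log (m / (2 * p)) := by
  rw [← Real.log_mul h₁.ne' h₂.ne', ← Real.log_mul (by positivity) (by positivity)]
  apply Real.log_le_log (by positivity)
  have : m / 2 * (m / (2 * p)) = m ^ 2 / 4 / p := by field_simp; norm_num
  rw [this, le_div_iff₀ hp]
  nlinarith [show 0 < c₁ + p * c₂ by positivity, sq_nonneg (c₁ - p * c₂)]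

/-- Demand of the logarithmic consumer. -/
theorem agentA_demand {p m c₁ c₂ : ℝ} (hp : 0 < p) (hm : 0 < m) (h₁ : 0 < c₁) (h₂ : 0 < c₂)
    (h : c₁ + p * c₂ ≤ m)
    (hopt : Real.log (m / 2) + Real.log (m / (2 * p)) ≤ Real.log c₁ + Real.log c₂) :
    c₁ = m / 2 ∧ c₂ = m / (2 * p) := by
  rw [← Real.log_mul h₁.ne' h₂.ne', ← Real.log_mul (by positivity) (by positivity),
    Real.log_le_log_iff (by positivity) (by positivity)] at hopt
  have : m / 2 * (m / (2 * p)) = m ^ 2 / 4 / p := by field_simp; norm_num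
  rw [this, div_le_iff₀ hp] at hopt
  have hpos : 0 < c₁ + p * c₂ := by positivity
  have hsq : (c₁ - p * c₂) ^ 2 ≤ 0 := by nlinarith
  have heq : c₁ - p * c₂ = 0 := pow_eq_zero_iff two_ne_zero |>.1 (le_antisymm hsq (sq_nonneg _))
  have hm2 : m ≤ 2 * c₁ := by
    have : c₁ ^ 2 = c₁ * c₂ * p := by
      linear_combination c₁ * heq
    exact abs_le_of_sq_le_sq' (by nlinarith) (by linarith) |>.2
  have hc₁ : c₁ = m / 2 := by linarith
  refine ⟨hc₁, ?_⟩
  rw [eq_div_iff (by positivity)]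
  linarith

/-- Agent B's bundle `(w - s, s / p)` is optimal when `s` is a small root of `s (w - s) = D`. -/
theorem agentB_utility_le {D s w p c₁ c₂ : ℝ} (hs : 0 < s) (hsD : 8 * s ^ 2 ≤ D)
    (hw : w * s = s ^ 2 + D) (hp : 0 < p) (h₁ : 0 ≤ c₁) (h₂ : 0 < c₂) (h : c₁ + p * c₂ ≤ w) :
    c₁ ^ 2 / 2 + D * Real.log c₂ ≤ (w - s) ^ 2 / 2 + D * Real.log (s / p) := by
  have hD : 0 < D := by nlinarith
  have hpc : 0 < p * c₂ := by positivity
  have hlog : Real.log c₂ + Real.log p ≤ Real.log (w - c₁) := by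
    rw [add_comm, ← Real.log_mul hp.ne' h₂.ne']
    exact Real.log_le_log hpc (by linarith)
  rw [Real.log_div hs.ne' hp.ne']
  have hmul := mul_le_mul_of_nonneg_left hlog hD.le
  rcases eq_or_ne (w - c₁) s with heq | hne
  · have hc₁ : c₁ = w - s := by linarith
    rw [heq] at hmul
    rw [hc₁]
    linarith
  · have := agentB_utility_lt hs hsD hw (x := w - c₁) (by linarith) (by linarith) hne
    rw [sub_sub_cancel] at this
    linarith

/-- Demand of agent B when `s` is a small root of `s (w - s) = D`. -/
theorem agentB_demand {D s w p c₁ c₂ : ℝ} (hs : 0 < s) (hsD : 8 * s ^ 2 ≤ D)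
    (hw : w * s = s ^ 2 + D) (hp : 0 < p) (h₁ : 0 ≤ c₁) (h₂ : 0 < c₂) (h : c₁ + p * c₂ ≤ w)
    (hopt : (w - s) ^ 2 / 2 + D * Real.log (s / p) ≤ c₁ ^ 2 / 2 + D * Real.log c₂) :
    c₁ = w - s ∧ c₂ = s / p := by
  have hD : 0 < D := by nlinarith
  have hpc : 0 < p * c₂ := by positivity
  have hc₁ : c₁ = w - s := by
    by_contra hne
    have hlog : Real.log c₂ + Real.log p ≤ Real.log (w - c₁) := by
      rw [add_comm, ← Real.log_mul hp.ne' h₂.ne']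
      exact Real.log_le_log hpc (by linarith)
    rw [Real.log_div hs.ne' hp.ne'] at hopt
    have hmul := mul_le_mul_of_nonneg_left hlog hD.le
    have := agentB_utility_lt hs hsD hw (x := w - c₁) (by linarith) (by linarith)
      (fun heq => hne (by linarith))
    rw [sub_sub_cancel] at this
    linarith
  refine ⟨hc₁, le_antisymm ?_ ?_⟩
  · rw [le_div_iff₀ hp]
    linarith
  · rw [hc₁, add_le_add_iff_left, mul_le_mul_iff_right₀ hD,
      Real.log_le_log_iff (by positivity) h₂] at hopt
    exact hopt

/-- For large `eA1`, every equilibrium is described by a small root `s` of a fixed quadratic. -/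
theorem LogEquil.exists_root {D eA1 eA2 eB1 eB2 p t : ℝ} {cA cB : ℝ × ℝ}
    (heA1 : 0 < eA1) (heA2 : 0 < eA2) (heB1 : 0 < eB1) (heB2 : 0 < eB2) (hD : 0 < D) (ht : 0 < t)
    (htD : 8 * t ^ 2 ≤ D) (hlarge : (eA2 + 2 * eB2) * (t ^ 2 + D) ≤ eA1 * eB2 * t)
    (h : LogEquil D eA1 eA2 eB1 eB2 1 p cA cB) :
    ∃ s, 0 < s ∧ 8 * s ^ 2 ≤ D ∧
      eA2 * s ^ 2 - (eA1 * eB2 + (eA2 + 2 * eB2) * eB1) * s + (eA2 + 2 * eB2) * D = 0 ∧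
      p * (eA2 + 2 * eB2) = eA1 + 2 * s ∧
      cA = ((eA1 + p * eA2) / 2, (eA1 + p * eA2) / (2 * p)) ∧
      cB = (eB1 + p * eB2 - s, s / p) ∧ s < eB1 + p * eB2 := by
  obtain ⟨-, hp, ⟨hA1, hA2, hA⟩, hAopt, ⟨hB1, hB2, hB⟩, hBopt, hclear1, hclear2⟩ := h
  obtain ⟨a1, a2⟩ := cA
  obtain ⟨b1, b2⟩ := cB
  simp only [one_mul] at *
  have hm : 0 < eA1 + p * eA2 := by positivity
  obtain ⟨ha1, ha2⟩ := agentA_demand hp hm hA1 hA2 hA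
    (hAopt (_, _) (by positivity) (by positivity) (by
      apply le_of_eq
      simp only
      field_simp
      ring))
  have hpa2 : a2 * (2 * p) = eA1 + p * eA2 := by
    rw [ha2]
    field_simp
  have hpK : eA1 ≤ p * (eA2 + 2 * eB2) := by nlinarith
  have hquad : 1 * t ^ 2 - (eB1 + p * eB2) * t + D ≤ 0 := by
    have hK : 0 < eA2 + 2 * eB2 := by positivity
    have := mul_le_mul_of_nonneg_right hpK (mul_pos heB2 ht).le
    have h3 : (eA2 + 2 * eB2) * (t ^ 2 + D) ≤ (eA2 + 2 * eB2) * (p * eB2 * t) := by linarith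
    have h4 := le_of_mul_le_mul_left h3 hK
    nlinarith
  obtain ⟨s, hs, hst, hroot⟩ := exists_quadratic_root hD ht hquad
  have hsD : 8 * s ^ 2 ≤ D := by nlinarith
  have hw : (eB1 + p * eB2) * s = s ^ 2 + D := by linarith
  have hsw : s < eB1 + p * eB2 := by nlinarith
  obtain ⟨hb1, hb2⟩ := agentB_demand hs hsD hw hp hB1 hB2 hB
    (hBopt (_, _) (by linarith) (by positivity) (by
      apply le_of_eq
      simp only
      field_simp
      ring))
  have hpb2 : p * b2 = s := by
    rw [hb2]
    field_simp
  have hprice : p * (eA2 + 2 * eB2) = eA1 + 2 * s := by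
    linear_combination (-2 * p) * hclear2 + hpa2 + 2 * hpb2
  refine ⟨s, hs, hsD, ?_, hprice, by rw [ha1, ha2], by rw [hb1, hb2], hsw⟩
  linear_combination (-(eA2 + 2 * eB2)) * hw + s * eB2 * hprice

/-- A small root of the quadratic gives an equilibrium. -/
theorem exists_logEquil_of_root {D eA1 eA2 eB1 eB2 s : ℝ}
    (heA1 : 0 < eA1) (heA2 : 0 < eA2) (heB2 : 0 < eB2) (hs : 0 < s)
    (hsD : 8 * s ^ 2 ≤ D)
    (hroot : eA2 * s ^ 2 - (eA1 * eB2 + (eA2 + 2 * eB2) * eB1) * s + (eA2 + 2 * eB2) * D = 0) :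
    ∃ p1 p2 : ℝ, ∃ cA cB : ℝ × ℝ, LogEquil D eA1 eA2 eB1 eB2 p1 p2 cA cB := by
  have hK : 0 < eA2 + 2 * eB2 := by positivity
  obtain ⟨p, hprice⟩ : ∃ p, p * (eA2 + 2 * eB2) = eA1 + 2 * s :=
    ⟨(eA1 + 2 * s) / (eA2 + 2 * eB2), div_mul_cancel₀ _ hK.ne'⟩
  have hp : 0 < p := pos_of_mul_pos_left (by rw [hprice]; positivity) hK.le
  have hw : (eB1 + p * eB2) * s = s ^ 2 + D := by
    apply mul_left_cancel₀ hK.ne'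
    linear_combination s * eB2 * hprice - hroot
  have hsw : s < eB1 + p * eB2 := by nlinarith
  refine ⟨1, p, ((eA1 + p * eA2) / 2, (eA1 + p * eA2) / (2 * p)), (eB1 + p * eB2 - s, s / p),
    one_pos, hp, ⟨by positivity, by positivity, ?_⟩, ?_, ⟨by simpa using hsw.le, by positivity, ?_⟩,
    ?_, ?_, ?_⟩
  · apply le_of_eq
    simp only
    field_simp
    ring
  · intro c h1 h2 h
    exact agentA_utility_le hp (by positivity) h1 h2 (by linarith)
  · apply le_of_eq
    simp only
    field_simp
    ring
  · intro c h1 h2 h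
    exact agentB_utility_le hs hsD hw hp h1 h2 (by linarith)
  · simp only
    linarith
  · simp only
    field_simp
    linarith

/-- The quadratic has at most one small root. -/
theorem small_root_unique {D a b K s t : ℝ} (ha : 0 < a) (haK : a < K) (hD : 0 < D)
    (hsD : 8 * s ^ 2 ≤ D) (htD : 8 * t ^ 2 ≤ D)
    (hsroot : a * s ^ 2 - b * s + K * D = 0) (htroot : a * t ^ 2 - b * t + K * D = 0) :
    s = t := by
  by_contra hne
  have hprod : a * (s * t) = K * D := by
    apply mul_left_cancel₀ (sub_ne_zero.2 hne)
    linear_combination t * hsroot - s * htroot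
  nlinarith [sq_nonneg (s - t), mul_lt_mul_of_pos_right haK hD]

/-- fixing `e^A₂, e^B₁, e^B₂, D`, for all large enough `e^A₁` an equilibrium
exists, is unique (same relative price and allocation), and satisfies `c^B₁ > 0`. -/
theorem equilibrium_large_eA1 (DD eA2 eB1 eB2 : ℝ)
    (heA2 : 0 < eA2) (heB1 : 0 < eB1) (heB2 : 0 < eB2) (hD : 0 < DD) :
    ∃ M : ℝ, 0 < M ∧ ∀ eA1 : ℝ, M ≤ eA1 →
      (∃ p1 p2 : ℝ, ∃ cA cB : ℝ × ℝ, LogEquil DD eA1 eA2 eB1 eB2 p1 p2 cA cB) ∧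
      (∀ p1 p2 q1 q2 : ℝ, ∀ cA cB dA dB : ℝ × ℝ,
        LogEquil DD eA1 eA2 eB1 eB2 p1 p2 cA cB →
        LogEquil DD eA1 eA2 eB1 eB2 q1 q2 dA dB →
        p2/p1 = q2/q1 ∧ cA = dA ∧ cB = dB) ∧
      (∀ p1 p2 : ℝ, ∀ cA cB : ℝ × ℝ,
        LogEquil DD eA1 eA2 eB1 eB2 p1 p2 cA cB → 0 < cB.1) := by
  obtain ⟨t, ht, htD⟩ : ∃ t : ℝ, 0 < t ∧ 8 * t ^ 2 = DD :=
    ⟨√(DD / 8), by positivity, by rw [Real.sq_sqrt (by positivity)]; ring⟩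
  have hK : 0 < eA2 + 2 * eB2 := by positivity
  refine ⟨(eA2 + 2 * eB2) * (t ^ 2 + DD) / (eB2 * t), by positivity, fun eA1 hM => ?_⟩
  have heA1 : 0 < eA1 := lt_of_lt_of_le (by positivity) hM
  rw [div_le_iff₀ (by positivity), ← mul_assoc] at hM
  refine ⟨?_, ?_, ?_⟩
  · have hquad : eA2 * t ^ 2 - (eA1 * eB2 + (eA2 + 2 * eB2) * eB1) * t
        + (eA2 + 2 * eB2) * DD ≤ 0 := by
      have h1 : 0 < eB2 * t ^ 2 := by positivity
      have h2 : 0 < (eA2 + 2 * eB2) * eB1 * t := by positivity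
      linarith
    obtain ⟨s, hs, hst, hroot⟩ := exists_quadratic_root (mul_pos hK hD) ht hquad
    exact exists_logEquil_of_root heA1 heA2 heB2 hs (by nlinarith) hroot
  · intro p1 p2 q1 q2 cA cB dA dB hp hq
    obtain ⟨s, hs, hsD, hsroot, hsp, hcA, hcB, -⟩ :=
      hp.normalize.exists_root heA1 heA2 heB1 heB2 hD ht htD.le hM
    obtain ⟨r, hr, hrD, hrroot, hrp, hdA, hdB, -⟩ :=
      hq.normalize.exists_root heA1 heA2 heB1 heB2 hD ht htD.le hM
    obtain rfl := small_root_unique heA2 (by linarith) hD hsD hrD hsroot hrroot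
    have hprice : p2 / p1 = q2 / q1 := mul_right_cancel₀ hK.ne' (hsp.trans hrp.symm)
    exact ⟨hprice, by rw [hcA, hdA, hprice], by rw [hcB, hdB, hprice]⟩
  · intro p1 p2 cA cB hp
    obtain ⟨s, -, -, -, -, -, hcB, hsw⟩ :=
      hp.normalize.exists_root heA1 heA2 heB1 heB2 hD ht htD.le hM
    rw [hcB]
    exact sub_pos.2 hsw
end

section
/- Fix e^A₁, e^A₂, e^B₁ > 0 and D > 0 and regard π^int as a function of e^B₂. Then Δ ≥ 0 (so π^int is defined) for all sufficiently large e^B₂, and lim_{e^B₂ → ∞} (e^B₁ + e^B₂·π^int) = (e^A₁ + 2e^B₁)/2 + 2D/(e^A₁ + 2e^B₁). -/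
open Filter Topology

/-- `Δ / (e^B₂)²` as a polynomial in `u = 1 / e^B₂`. -/
noncomputable def scaledDelta (DD eA1 eA2 eB1 u : ℝ) : ℝ :=
  (eA1 + 2*eB1 + (eB1+eA1)*eA2*u)^2
    - (2*eA2*u + eA2^2*u^2) * ((eB1+eA1)^2 + 4*DD - eB1^2)

theorem Delta_eq_sq_mul_scaledDelta (DD eA1 eA2 eB1 : ℝ) {b : ℝ} (hb : b ≠ 0) :
    Delta DD eA1 eA2 eB1 b = b^2 * scaledDelta DD eA1 eA2 eB1 b⁻¹ := by
  unfold Delta scaledDelta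
  field_simp
  ring

theorem tendsto_scaledDelta (DD eA1 eA2 eB1 : ℝ) :
    Tendsto (scaledDelta DD eA1 eA2 eB1) (𝓝 0) (𝓝 ((eA1 + 2*eB1)^2)) := by
  have h : Continuous (scaledDelta DD eA1 eA2 eB1) := by
    unfold scaledDelta
    fun_prop
  simpa [scaledDelta] using h.tendsto 0

/-- Rationalised form of `e^B₂ π^int`. -/
theorem mul_piInt_eq (DD eA1 eA2 eB1 : ℝ) {b : ℝ}
    (heA1 : 0 < eA1) (heA2 : 0 < eA2) (heB1 : 0 < eB1) (hb : 0 < b)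
    (hΔ : 0 ≤ scaledDelta DD eA1 eA2 eB1 b⁻¹) :
    b * piInt DD eA1 eA2 eB1 b =
      ((eB1+eA1)^2 + 4*DD - eB1^2) /
        (eA1 + 2*eB1 + (eB1+eA1)*eA2*b⁻¹ + √(scaledDelta DD eA1 eA2 eB1 b⁻¹)) := by
  have hsqrt : √(Delta DD eA1 eA2 eB1 b) = b * √(scaledDelta DD eA1 eA2 eB1 b⁻¹) := by
    rw [Delta_eq_sq_mul_scaledDelta DD eA1 eA2 eB1 hb.ne', Real.sqrt_mul (sq_nonneg b),
      Real.sqrt_sq hb.le]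
  have hsq := Real.sq_sqrt hΔ
  have hr := Real.sqrt_nonneg (scaledDelta DD eA1 eA2 eB1 b⁻¹)
  rw [piInt, hsqrt]
  set r := √(scaledDelta DD eA1 eA2 eB1 b⁻¹)
  have hden : 0 < (b + eA2)^2 - b^2 := by
    have : (b + eA2)^2 - b^2 = eA2 * (2*b + eA2) := by ring
    rw [this]
    positivity
  have hden' : 0 < eA1 + 2*eB1 + (eB1+eA1)*eA2*b⁻¹ + r := by positivity
  rw [← mul_div_assoc, div_eq_div_iff hden.ne' hden'.ne']
  have hnum : (eB1+eA1)*(b+eA2) + eB1*b = b * (eA1 + 2*eB1 + (eB1+eA1)*eA2*b⁻¹) := by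
    field_simp
    ring
  have hfac : (b + eA2)^2 - b^2 = b^2 * (2*eA2*b⁻¹ + eA2^2*b⁻¹^2) := by
    field_simp
    ring
  rw [hnum, hfac]
  unfold scaledDelta at hsq
  linear_combination (-b^2) * hsq

/-- for fixed `e^A₁, e^A₂, e^B₁ > 0` and `D > 0`, `Δ ≥ 0` for all
sufficiently large `e^B₂`, and
`e^B₁ + e^B₂ π^int → (e^A₁ + 2e^B₁)/2 + 2D/(e^A₁ + 2e^B₁)` as `e^B₂ → ∞`. -/
theorem piInt_limit_eB2 (DD eA1 eA2 eB1 : ℝ)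
    (heA1 : 0 < eA1) (heA2 : 0 < eA2) (heB1 : 0 < eB1) (hD : 0 < DD) :
    (∀ᶠ b2 : ℝ in Filter.atTop, 0 ≤ Delta DD eA1 eA2 eB1 b2) ∧
    Filter.Tendsto (fun b2 : ℝ => eB1 + b2 * piInt DD eA1 eA2 eB1 b2) Filter.atTop
      (nhds ((eA1 + 2*eB1)/2 + 2*DD/(eA1 + 2*eB1))) := by
  have hS : 0 < eA1 + 2*eB1 := by positivity
  have hlim := (tendsto_scaledDelta DD eA1 eA2 eB1).comp tendsto_inv_atTop_zero
  have hpos : ∀ᶠ b : ℝ in atTop, 0 < scaledDelta DD eA1 eA2 eB1 b⁻¹ :=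
    hlim.eventually_const_lt (by positivity)
  constructor
  · filter_upwards [hpos, eventually_gt_atTop 0] with b hΔ hb
    rw [Delta_eq_sq_mul_scaledDelta DD eA1 eA2 eB1 hb.ne']
    positivity
  · have hsqrt : Tendsto (fun b : ℝ => √(scaledDelta DD eA1 eA2 eB1 b⁻¹)) atTop
        (𝓝 (eA1 + 2*eB1)) := by
      simpa [Real.sqrt_sq hS.le] using hlim.sqrt
    have hlin : Tendsto (fun b : ℝ => eA1 + 2*eB1 + (eB1+eA1)*eA2*b⁻¹) atTop
        (𝓝 (eA1 + 2*eB1)) := by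
      simpa using (tendsto_inv_atTop_zero.const_mul ((eB1+eA1)*eA2)).const_add (eA1 + 2*eB1)
    have hquot := ((tendsto_const_nhds (x := (eB1+eA1)^2 + 4*DD - eB1^2)).div
      (hlin.add hsqrt) (by positivity)).const_add eB1
    have hval : eB1 + ((eB1+eA1)^2 + 4*DD - eB1^2) / (eA1 + 2*eB1 + (eA1 + 2*eB1)) =
        (eA1 + 2*eB1)/2 + 2*DD/(eA1 + 2*eB1) := by
      field_simp
      ring
    rw [hval] at hquot
    refine hquot.congr' ?_
    filter_upwards [hpos, eventually_gt_atTop 0] with b hΔ hb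
    rw [mul_piInt_eq DD eA1 eA2 eB1 heA1 heA2 heB1 hb hΔ.le]
    rfl
end
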